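/- Let K ⊂ ℝ³ be a convex body and α > 0. Suppose there is a continuous system of lines 𝓛 in ℝ³ whose center is contained in the interior of K, and for every line L ∈ 𝓛 there are two planes H₁, H₂ with H₁ ∩ H₂ = L, forming an angle at least α with each other, such that bd K ∩ H₁ and bd K ∩ H₂ are ellipses and at least one of these two sections is a circle. Then bd K is a sphere. -/

import Mathlib

open scoped RealInnerProductSpace
open MeasureTheory

noncomputable section

/-- Euclidean 3-space. -/
abbrev E3 : Type := EuclideanSpace ℝ (Fin 3)

/-- The line through `p` with direction vector `v`. -/
def lineThrough (p v : E3) : Set E3 := {x : E3 | ∃ t : ℝ, x = p + t • v}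

/-- A line in `ℝ³`. -/
def IsLine (L : Set E3) : Prop := ∃ p v : E3, v ≠ 0 ∧ L = lineThrough p v

/-- A plane in `ℝ³` with prescribed unit normal `n`. -/
def IsPlaneWithNormal (H : Set E3) (n : E3) : Prop :=
  ‖n‖ = 1 ∧ ∃ c : ℝ, H = {x : E3 | ⟪n, x⟫ = c}

/-- A plane in `ℝ³`. -/
def IsPlane (H : Set E3) : Prop := ∃ n : E3, IsPlaneWithNormal H n

/-- The unit circle `{(cos t, sin t, 0)}` in the plane `z = 0`. -/
def unitCircle3 : Set E3 := {x : E3 | x 0 ^ 2 + x 1 ^ 2 = 1 ∧ x 2 = 0}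

/-- An ellipse in `ℝ³`: the image of the unit circle under an invertible affine map. -/
def IsEllipse (E : Set E3) : Prop := ∃ f : E3 ≃ᵃ[ℝ] E3, E = f '' unitCircle3

/-- An ellipsoid in `ℝ³`: the image of the unit sphere under an invertible affine map. -/
def IsEllipsoid (S : Set E3) : Prop := ∃ f : E3 ≃ᵃ[ℝ] E3, S = f '' Metric.sphere (0 : E3) 1

/-- A circle in `ℝ³`: the points of some plane at fixed positive distance from a
center lying in that plane. -/
def IsCircle (C : Set E3) : Prop :=
  ∃ (H : Set E3) (c : E3) (r : ℝ), IsPlane H ∧ c ∈ H ∧ 0 < r ∧ C = {x ∈ H | dist x c = r}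

/-- A sphere in `ℝ³`. -/
def IsSphere (S : Set E3) : Prop := ∃ (c : E3) (r : ℝ), 0 < r ∧ S = Metric.sphere c r

/-- A convex body: compact, convex, with nonempty interior. -/
def IsConvexBody (K : Set E3) : Prop := IsCompact K ∧ Convex ℝ K ∧ (interior K).Nonempty

/-- A line `L` is tangent to `bd K` if it meets `K` but not the interior of `K`. -/
def IsTangentLine (K L : Set E3) : Prop := (L ∩ K).Nonempty ∧ L ∩ interior K = ∅

/-- An outward function on the boundary of a convex body `K`. -/
def IsOutwardFunction (K : Set E3) (Ψ : E3 → E3) : Prop :=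
  ContinuousOn Ψ (frontier K) ∧
  ∀ p ∈ frontier K, ‖Ψ p‖ = 1 ∧
    ¬ IsTangentLine K (lineThrough p (Ψ p)) ∧
    (∀ t : ℝ, 0 < t → p + t • Ψ p ∉ K) ∧
    ∃ q ∈ frontier K, q ∉ lineThrough p (Ψ p) ∧
      (lineThrough p (Ψ p) ∩ lineThrough q (Ψ q) ∩ interior K).Nonempty

/-- `L` is a line parallel to the direction `u`. -/
def LineParallel (L : Set E3) (u : E3) : Prop := ∃ p : E3, L = lineThrough p u

/-- A system of lines: for every direction `u ∈ S²` exactly one member line parallel to `u`. -/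
def IsLineSystem (𝓛 : Set (Set E3)) : Prop :=
  (∀ L ∈ 𝓛, IsLine L) ∧ ∀ u : E3, ‖u‖ = 1 → ∃! L, L ∈ 𝓛 ∧ LineParallel L u

/-- A continuous system of lines: the map `δ` sending each direction `u ∈ S²` to the point
of `L_u` closest to the origin is continuous. -/
def IsContinuousLineSystem (𝓛 : Set (Set E3)) : Prop :=
  IsLineSystem 𝓛 ∧ ∃ δ : E3 → E3, ContinuousOn δ (Metric.sphere (0 : E3) 1) ∧
    ∀ u : E3, ‖u‖ = 1 → ∀ L ∈ 𝓛, LineParallel L u →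
      δ u ∈ L ∧ ∀ x ∈ L, ‖δ u‖ ≤ ‖x‖

/-- The center of a system of lines: points lying on at least two distinct lines. -/
def lineSystemCenter (𝓛 : Set (Set E3)) : Set E3 :=
  {x : E3 | ∃ L₁ ∈ 𝓛, ∃ L₂ ∈ 𝓛, L₁ ≠ L₂ ∧ x ∈ L₁ ∧ x ∈ L₂}

/-- A smooth convex body: each boundary point has a unique (unit outer normal of a)
support plane. -/
def IsSmoothBody (K : Set E3) : Prop :=
  ∀ p ∈ frontier K, ∃! n : E3, ‖n‖ = 1 ∧ ∀ x ∈ K, ⟪n, x⟫ ≤ ⟪n, p⟫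

/-- A strictly convex body: the boundary contains no line segment. -/
def IsStrictlyConvexBody (K : Set E3) : Prop :=
  ∀ x ∈ frontier K, ∀ y ∈ frontier K, x ≠ y → ¬ segment ℝ x y ⊆ frontier K

/-- `η` is an outer unit normal field of `K` on its boundary. -/
def IsOuterNormal (K : Set E3) (η : E3 → E3) : Prop :=
  ∀ p ∈ frontier K, ‖η p‖ = 1 ∧ ∀ x ∈ K, ⟪η p, x⟫ ≤ ⟪η p, p⟫

/-- The boundary of `K` is a `C^k` surface: locally, after a rigid motion, it is the graph
of a `C^k` function of two variables. -/
def HasContDiffBoundary (K : Set E3) (k : ℕ) : Prop :=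
  ∀ p ∈ frontier K, ∃ (e : E3 ≃ᵃⁱ[ℝ] E3) (g : ℝ × ℝ → ℝ) (U : Set E3),
    IsOpen U ∧ p ∈ U ∧ ContDiff ℝ k g ∧
    frontier K ∩ U = {x ∈ U | e x 2 = g (e x 0, e x 1)}

end

section

open Filter Topology

theorem E3.inner_def (x y : E3) : ⟪x, y⟫ = x 0 * y 0 + x 1 * y 1 + x 2 * y 2 := by
  simp [PiLp.inner_apply, Fin.sum_univ_three]; ring

/-- Three vectors orthogonal to a nonzero vector of `E3` are linearly dependent. -/
theorem exists_dependent_of_orthogonal {n u v w : E3} (hn : n ≠ 0) (hu : ⟪n, u⟫ = 0)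
    (hv : ⟪n, v⟫ = 0) (hw : ⟪n, w⟫ = 0) :
    ∃ a b c : ℝ, ¬ (a = 0 ∧ b = 0 ∧ c = 0) ∧ a • u + b • v + c • w = 0 := by
  let M : Matrix (Fin 3) (Fin 3) ℝ := ![u.ofLp, v.ofLp, w.ofLp]
  have h1 : M.det = 0 := by
    rw [← Matrix.exists_mulVec_eq_zero_iff]
    refine ⟨n.ofLp, fun h => hn (by ext i; exact congrFun h i), ?_⟩
    rw [E3.inner_def] at hu hv hw
    ext i
    fin_cases i <;> simp [M, Matrix.mulVec, dotProduct, Fin.sum_univ_three] <;> linarith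
  rw [← Matrix.exists_vecMul_eq_zero_iff] at h1
  obtain ⟨c, hc, h⟩ := h1
  refine ⟨c 0, c 1, c 2, fun h0 => hc ?_, ?_⟩
  · ext i
    fin_cases i
    exacts [h0.1, h0.2.1, h0.2.2]
  · ext i
    have := congrFun h i
    simpa [M, Matrix.vecMul, dotProduct, Fin.sum_univ_three] using this

/-- Two vectors of `E3` have a common nonzero orthogonal vector. -/
theorem exists_orthogonal (u v : E3) : ∃ d : E3, d ≠ 0 ∧ ⟪u, d⟫ = 0 ∧ ⟪v, d⟫ = 0 := by
  let M : Matrix (Fin 3) (Fin 3) ℝ := ![u.ofLp, v.ofLp, 0]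
  have h1 : M.det = 0 := Matrix.det_eq_zero_of_row_eq_zero 2 (fun j => by simp [M])
  rw [← Matrix.exists_mulVec_eq_zero_iff] at h1
  obtain ⟨c, hc, h⟩ := h1
  refine ⟨WithLp.toLp 2 c, fun h0 => hc ?_, ?_, ?_⟩
  · simpa using h0
  · have := congrFun h 0
    rw [E3.inner_def]
    simpa [M, Matrix.mulVec, dotProduct, Fin.sum_univ_three] using this
  · have := congrFun h 1
    rw [E3.inner_def]
    simpa [M, Matrix.mulVec, dotProduct, Fin.sum_univ_three] using this

/-- Non-parallelism of two vectors, expressed by strict Cauchy-Schwarz. -/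
def Indep (u v : E3) : Prop := ⟪u, v⟫ ^ 2 < ‖u‖ ^ 2 * ‖v‖ ^ 2

theorem Indep.symm {u v : E3} (h : Indep u v) : Indep v u := by
  unfold Indep at *
  rw [real_inner_comm]; linarith [mul_comm (‖u‖ ^ 2) (‖v‖ ^ 2)]

theorem Indep.ne_left {u v : E3} (h : Indep u v) : u ≠ 0 := by
  rintro rfl; simp [Indep] at h

theorem Indep.ne_right {u v : E3} (h : Indep u v) : v ≠ 0 := h.symm.ne_left

theorem Indep.eq_zero {u v : E3} (h : Indep u v) {a b : ℝ} (hab : a • u + b • v = 0) :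
    a = 0 ∧ b = 0 := by
  have hu : a * ⟪u, u⟫ + b * ⟪u, v⟫ = 0 := by
    have := congrArg (fun x => ⟪u, x⟫) hab
    simpa [inner_add_right, real_inner_smul_right] using this
  have hv : a * ⟪u, v⟫ + b * ⟪v, v⟫ = 0 := by
    have := congrArg (fun x => ⟪v, x⟫) hab
    simpa [inner_add_right, real_inner_smul_right, real_inner_comm] using this
  unfold Indep at h
  rw [← real_inner_self_eq_norm_sq, ← real_inner_self_eq_norm_sq] at h
  have hd : ⟪u, u⟫ * ⟪v, v⟫ - ⟪u, v⟫ ^ 2 ≠ 0 := by linarith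
  constructor
  · apply (mul_eq_zero.1 (?_ : a * (⟪u, u⟫ * ⟪v, v⟫ - ⟪u, v⟫ ^ 2) = 0)).resolve_right hd
    linear_combination ⟪v, v⟫ * hu - ⟪u, v⟫ * hv
  · apply (mul_eq_zero.1 (?_ : b * (⟪u, u⟫ * ⟪v, v⟫ - ⟪u, v⟫ ^ 2) = 0)).resolve_right hd
    linear_combination ⟪u, u⟫ * hv - ⟪u, v⟫ * hu

/-- Equality in Cauchy-Schwarz gives proportionality. -/
theorem exists_smul_of_not_indep {u v : E3} (hu : u ≠ 0) (h : ¬ Indep u v) :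
    ∃ k : ℝ, v = k • u := by
  refine ⟨⟪u, v⟫ / ‖u‖ ^ 2, ?_⟩
  have hu' : ‖u‖ ^ 2 ≠ 0 := by simpa using hu
  unfold Indep at h
  rw [← sub_eq_zero, ← norm_eq_zero, ← sq_eq_zero_iff, norm_sub_sq_real, norm_smul,
    real_inner_smul_right, real_inner_comm u v, mul_pow, Real.norm_eq_abs, sq_abs]
  have h1 : ⟪u, v⟫ ^ 2 ≤ ‖u‖ ^ 2 * ‖v‖ ^ 2 := by
    have := abs_real_inner_le_norm u v
    rw [← mul_pow]
    exact sq_le_sq' (by linarith [neg_abs_le ⟪u, v⟫]) (le_trans (le_abs_self _) this)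
  have h2 : ⟪u, v⟫ ^ 2 = ‖u‖ ^ 2 * ‖v‖ ^ 2 := by linarith
  field_simp
  linear_combination (-1) * h2

theorem not_indep_smul (u : E3) (k : ℝ) : ¬ Indep u (k • u) := by
  unfold Indep
  rw [norm_smul, real_inner_smul_right, real_inner_self_eq_norm_sq, mul_pow, mul_pow,
    Real.norm_eq_abs, sq_abs]
  exact not_lt.2 (le_of_eq (by ring))

theorem indep_of_eq_zero {u v : E3} (hu : u ≠ 0) (h : ∀ k : ℝ, v ≠ k • u) : Indep u v := by
  by_contra h'
  obtain ⟨k, hk⟩ := exists_smul_of_not_indep hu h'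
  exact h k hk

theorem exists_combination {n d e w : E3} (hn : n ≠ 0) (hd : ⟪n, d⟫ = 0) (he : ⟪n, e⟫ = 0)
    (hw : ⟪n, w⟫ = 0) (hde : Indep d e) : ∃ a b : ℝ, w = a • d + b • e := by
  obtain ⟨a, b, c, h0, h⟩ := exists_dependent_of_orthogonal hn hw hd he
  have ha : a ≠ 0 := by
    rintro rfl
    have := hde.eq_zero (a := b) (b := c) (by simpa using h)
    exact h0 ⟨rfl, this.1, this.2⟩
  refine ⟨-b / a, -c / a, ?_⟩
  have : a • w = (-b) • d + (-c) • e := by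
    linear_combination (norm := module) h
  calc w = a⁻¹ • (a • w) := by rw [smul_smul, inv_mul_cancel₀ ha, one_smul]
    _ = _ := by rw [this, smul_add, smul_smul, smul_smul]; ring_nf

/-- The plane through `y` orthogonal to `n`. -/
def planeAt (y n : E3) : Set E3 := {x | ⟪n, x - y⟫ = 0}

/-- All points of `A` have the same squared distance `ρ` to `m`. -/
def OnSphere (A : Set E3) (m : E3) (ρ : ℝ) : Prop := ∀ x ∈ A, ‖x - m‖ ^ 2 = ρ

/-- Two non-parallel planes, given by a point and a normal, that meet in the interior of `K`. -/
def Crossing (K : Set E3) (y n y' n' : E3) : Prop :=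
  Indep n n' ∧ ∃ x ∈ interior K, x ∈ planeAt y n ∧ x ∈ planeAt y' n'

theorem mem_planeAt {x y n : E3} : x ∈ planeAt y n ↔ ⟪n, x - y⟫ = 0 := Iff.rfl

theorem self_mem_planeAt (y n : E3) : y ∈ planeAt y n := by simp [mem_planeAt]

theorem planeAt_congr {y z n : E3} (h : z ∈ planeAt y n) : planeAt y n = planeAt z n := by
  ext x
  rw [mem_planeAt] at *
  rw [mem_planeAt, ← sub_add_sub_cancel x z y, inner_add_right, h, add_zero]

theorem planeAt_smul (y n : E3) {k : ℝ} (hk : k ≠ 0) : planeAt y (k • n) = planeAt y n := by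
  ext x
  simp [mem_planeAt, real_inner_smul_left, hk]

theorem add_smul_mem_planeAt {y n x d : E3} (hx : x ∈ planeAt y n) (hd : ⟪n, d⟫ = 0) (t : ℝ) :
    x + t • d ∈ planeAt y n := by
  rw [mem_planeAt] at *
  rw [show x + t • d - y = (x - y) + t • d by abel, inner_add_right, hx, real_inner_smul_right, hd]
  simp

theorem inner_sub_eq_zero_of_mem {y n x x' : E3} (hx : x ∈ planeAt y n) (hx' : x' ∈ planeAt y n) :
    ⟪n, x - x'⟫ = 0 := by
  rw [mem_planeAt] at *
  rw [← sub_sub_sub_cancel_right x x' y, inner_sub_right, hx, hx', sub_zero]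

theorem Crossing.symm {K : Set E3} {y n y' n' : E3} (h : Crossing K y n y' n') :
    Crossing K y' n' y n := by
  obtain ⟨h, x, hx, h1, h2⟩ := h
  exact ⟨h.symm, x, hx, h2, h1⟩

section Body

variable {K : Set E3}

theorem mem_frontier_iff' (hK : IsCompact K) {x : E3} :
    x ∈ frontier K ↔ x ∈ K ∧ x ∉ interior K := by
  rw [frontier, hK.isClosed.closure_eq, Set.mem_sdiff]

theorem between_mem_interior (hc : Convex ℝ K) {b x : E3} (hb : b ∈ interior K) (hx : x ∈ K)
    {t : ℝ} (h0 : 0 ≤ t) (h1 : t < 1) : b + t • (x - b) ∈ interior K := by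
  rcases eq_or_lt_of_le h0 with rfl | h0
  · simpa using hb
  apply hc.openSegment_interior_closure_subset_interior hb (subset_closure hx)
  exact ⟨1 - t, t, by linarith, h0, by ring, by module⟩

/-- A ray from an interior point leaves a convex body through a frontier point. -/
theorem exists_exit (hK : IsCompact K) (hc : Convex ℝ K) {b v : E3} (hb : b ∈ interior K)
    (hv : v ≠ 0) : ∃ s : ℝ, 0 < s ∧ b + s • v ∈ frontier K ∧
      (∀ t : ℝ, 0 ≤ t → t < s → b + t • v ∈ interior K) ∧ ∀ t : ℝ, s < t → b + t • v ∉ K := by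
  have hcont : Continuous fun t : ℝ => b + t • v := by fun_prop
  let T : Set ℝ := {t | 0 ≤ t ∧ b + t • v ∈ K}
  have hTclosed : IsClosed T := isClosed_Ici.inter (hK.isClosed.preimage hcont)
  obtain ⟨R, hR⟩ := hK.isBounded.exists_norm_le
  have hTb : T ⊆ Set.Icc 0 ((R + ‖b‖) / ‖v‖) := by
    rintro t ⟨h0, ht⟩
    refine ⟨h0, ?_⟩
    rw [le_div_iff₀ (norm_pos_iff.2 hv)]
    have h1 := hR _ ht
    have h2 : ‖t • v‖ = t * ‖v‖ := by rw [norm_smul, Real.norm_of_nonneg h0]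
    have h3 : ‖t • v‖ ≤ ‖b + t • v‖ + ‖b‖ := by
      have := norm_sub_le (b + t • v) b
      simpa using this
    linarith
  have hTc : IsCompact T := isCompact_Icc.of_isClosed_subset hTclosed hTb
  obtain ⟨s, hs⟩ := hTc.exists_isGreatest ⟨0, le_refl _, by simpa using interior_subset hb⟩
  have hnear : ∀ t₀ : ℝ, b + t₀ • v ∈ interior K → ∃ t > t₀, b + t • v ∈ K := by
    intro t₀ ht₀
    have h1 : ∀ᶠ t in 𝓝 t₀, b + t • v ∈ interior K :=
      hcont.continuousAt.eventually (isOpen_interior.mem_nhds ht₀)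
    obtain ⟨t, ht, ht'⟩ := ((h1.filter_mono nhdsWithin_le_nhds).and
      (self_mem_nhdsWithin : Set.Ioi t₀ ∈ 𝓝[>] t₀)).exists
    exact ⟨t, ht', interior_subset ht⟩
  have hs0 : 0 < s := by
    obtain ⟨t, ht, ht'⟩ := hnear 0 (by simpa using hb)
    exact ht.trans_le (hs.2 ⟨ht.le, ht'⟩)
  refine ⟨s, hs0, (mem_frontier_iff' hK).2 ⟨hs.1.2, fun h => ?_⟩, fun t h0 ht => ?_,
    fun t ht h => ?_⟩
  · obtain ⟨t, ht, ht'⟩ := hnear s h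
    exact absurd (hs.2 ⟨hs0.le.trans ht.le, ht'⟩) (not_le.2 ht)
  · have := between_mem_interior hc hb hs.1.2 (div_nonneg h0 hs0.le) ((div_lt_one hs0).2 ht)
    rwa [add_sub_cancel_left, smul_smul, div_mul_cancel₀ _ hs0.ne'] at this
  · exact absurd (hs.2 ⟨hs0.le.trans ht.le, h⟩) (not_le.2 ht)

theorem exists_frontier_between (hK : IsCompact K) (hc : Convex ℝ K) {p q : E3}
    (hp : p ∈ interior K) (hq : q ∉ K) :
    ∃ t : ℝ, 0 ≤ t ∧ t ≤ 1 ∧ p + t • (q - p) ∈ frontier K := by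
  have hpq : q - p ≠ 0 := by
    rw [sub_ne_zero]; rintro rfl; exact hq (interior_subset hp)
  obtain ⟨s, hs, h1, h2, -⟩ := exists_exit hK hc hp hpq
  refine ⟨s, hs.le, not_lt.1 fun h => hq ?_, h1⟩
  simpa using interior_subset (h2 1 zero_le_one h)

theorem beyond_not_mem (hK : IsCompact K) (hc : Convex ℝ K) {b x : E3} (hb : b ∈ interior K)
    (hx : x ∈ frontier K) {t : ℝ} (ht : 1 < t) : b + t • (x - b) ∉ K := by
  intro h
  have := between_mem_interior hc hb h (t := 1 / t) (by positivity)
    ((div_lt_one (by positivity)).2 ht)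
  rw [add_sub_cancel_left, smul_smul, one_div, inv_mul_cancel₀ (by positivity), one_smul,
    add_sub_cancel] at this
  exact ((mem_frontier_iff' hK).1 hx).2 this

/-- Frontier points of a plane section that meets the interior persist on nearby planes. -/
theorem eventually_exists_frontier (hK : IsCompact K) (hc : Convex ℝ K) {x y n b : E3} {V : Set E3}
    (hV : V ∈ 𝓝 x) (hx : x ∈ frontier K) (hxp : x ∈ planeAt y n) (hn : n ≠ 0)
    (hb : b ∈ interior K) (hbp : b ∈ planeAt y n) :
    ∀ᶠ p in 𝓝 (y, n), ∃ x' ∈ V, x' ∈ frontier K ∧ x' ∈ planeAt p.1 p.2 := by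
  obtain ⟨δ, hδ, hδV⟩ := Metric.mem_nhds_iff.1 hV
  have hl : Continuous fun t : ℝ => x + t • (b - x) := by fun_prop
  have h0 : ∀ᶠ t in 𝓝 (0 : ℝ), x + t • (b - x) ∈ Metric.ball x δ :=
    hl.continuousAt.eventually (Metric.isOpen_ball.mem_nhds (by simpa using hδ))
  have h0' : ∀ᶠ t in 𝓝 (0 : ℝ), x + (-t) • (b - x) ∈ Metric.ball x δ := by
    have : Continuous fun t : ℝ => x + (-t) • (b - x) := by fun_prop
    exact this.continuousAt.eventually (Metric.isOpen_ball.mem_nhds (by simpa using hδ))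
  obtain ⟨ε, ⟨h1, h2, h3⟩, h4⟩ := (((h0.and (h0'.and (eventually_lt_nhds one_pos))).filter_mono
    nhdsWithin_le_nhds).and (self_mem_nhdsWithin : Set.Ioi (0 : ℝ) ∈ 𝓝[>] 0)).exists
  replace h4 : 0 < ε := h4
  let P : ℝ → E3 × E3 → E3 := fun t p =>
    (x + t • (b - x)) - (⟪p.2, x + t • (b - x) - p.1⟫ / ‖p.2‖ ^ 2) • p.2
  have hP0 : ∀ t, P t (y, n) = x + t • (b - x) := by
    intro t
    have : x + t • (b - x) ∈ planeAt y n :=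
      add_smul_mem_planeAt hxp (inner_sub_eq_zero_of_mem hbp hxp) t
    simp only [P]
    rw [mem_planeAt.1 this]; simp
  have hPc : ∀ t, ContinuousAt (P t) (y, n) := by
    intro t
    have : ‖(y, n).2‖ ^ 2 ≠ 0 := by simpa using hn
    simp only [P]
    fun_prop (disch := assumption)
  have hPp : ∀ t p, p.2 ≠ 0 → P t p ∈ planeAt p.1 p.2 := by
    intro t p hp
    have : ‖p.2‖ ^ 2 ≠ 0 := by simpa using hp
    rw [mem_planeAt]
    simp only [P]
    rw [sub_right_comm, inner_sub_right, real_inner_smul_right, real_inner_self_eq_norm_sq,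
      div_mul_cancel₀ _ this, sub_self]
  have hi : x + ε • (b - x) ∈ interior K := by
    have := between_mem_interior hc hb ((mem_frontier_iff' hK).1 hx).1 (t := 1 - ε) (by linarith)
      (by linarith)
    convert this using 1; module
  have ho : x + (-ε) • (b - x) ∉ K := by
    have := beyond_not_mem hK hc hb hx (t := 1 + ε) (by linarith)
    convert this using 2; module
  have e1 : ∀ᶠ p in 𝓝 (y, n), P ε p ∈ interior K ∩ Metric.ball x δ :=
    (hPc ε).eventually ((isOpen_interior.inter Metric.isOpen_ball).mem_nhds
      (by rw [hP0]; exact ⟨hi, h1⟩))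
  have e2 : ∀ᶠ p in 𝓝 (y, n), P (-ε) p ∈ Kᶜ ∩ Metric.ball x δ :=
    (hPc (-ε)).eventually ((hK.isClosed.isOpen_compl.inter Metric.isOpen_ball).mem_nhds
      (by rw [hP0]; exact ⟨ho, h2⟩))
  have e3 : ∀ᶠ p : E3 × E3 in 𝓝 (y, n), p.2 ≠ 0 :=
    continuousAt_snd.eventually (eventually_ne_nhds (show (y, n).2 ≠ 0 from hn))
  filter_upwards [e1, e2, e3] with p hp1 hp2 hp3
  obtain ⟨t, ht0, ht1, ht⟩ := exists_frontier_between hK hc hp1.1 hp2.1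
  refine ⟨_, hδV ?_, ht, ?_⟩
  · have := (convex_ball x δ) hp1.2 hp2.2 (a := 1 - t) (b := t) (by linarith) ht0 (by ring)
    convert this using 1; module
  · exact add_smul_mem_planeAt (hPp _ _ hp3)
      (inner_sub_eq_zero_of_mem (hPp _ _ hp3) (hPp _ _ hp3)) t

/-- A plane through the interior does not contain a neighbourhood in the frontier. -/
theorem exists_frontier_off_plane (hK : IsCompact K) (hc : Convex ℝ K) {x y n b : E3} {V : Set E3}
    (hV : V ∈ 𝓝 x) (hx : x ∈ frontier K) (hn : n ≠ 0)
    (hb : b ∈ interior K) (hbp : b ∈ planeAt y n) :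
    ∃ x' ∈ V, x' ∈ frontier K ∧ x' ∉ planeAt y n := by
  by_cases hxp : x ∈ planeAt y n
  · have h := eventually_exists_frontier hK hc hV hx hxp hn hb hbp
    have hcont : Tendsto (fun t : ℝ => (y + t • n, n)) (𝓝[>] 0) (𝓝 (y, n)) := by
      have : Continuous fun t : ℝ => (y + t • n, n) := by fun_prop
      have := this.tendsto 0
      simp only [zero_smul, add_zero] at this
      exact this.mono_left nhdsWithin_le_nhds
    obtain ⟨t, ⟨x', h1, h2, h3⟩, ht⟩ := ((hcont.eventually h).and
      (self_mem_nhdsWithin : Set.Ioi (0 : ℝ) ∈ 𝓝[>] 0)).exists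
    refine ⟨x', h1, h2, fun h4 => ?_⟩
    rw [mem_planeAt] at h3 h4
    simp only at h3
    rw [← sub_sub, inner_sub_right, h4, real_inner_smul_right, real_inner_self_eq_norm_sq] at h3
    have : 0 < t * ‖n‖ ^ 2 := mul_pos ht (by positivity)
    linarith
  · exact ⟨x, mem_of_mem_nhds hV, hx, hxp⟩

/-- Crossing is an open condition. -/
theorem Crossing.eventually {y n y' n' : E3} (h : Crossing K y n y' n') :
    ∀ᶠ p in 𝓝 ((y, n), (y', n')), Crossing K p.1.1 p.1.2 p.2.1 p.2.2 := by
  obtain ⟨h, x, hx, h1, h2⟩ := h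
  rw [mem_planeAt] at h1 h2
  let Δ : (E3 × E3) × (E3 × E3) → ℝ := fun p => ‖p.1.2‖ ^ 2 * ‖p.2.2‖ ^ 2 - ⟪p.1.2, p.2.2⟫ ^ 2
  let A : (E3 × E3) × (E3 × E3) → ℝ := fun p =>
    (⟪p.1.2, x - p.1.1⟫ * ‖p.2.2‖ ^ 2 - ⟪p.2.2, x - p.2.1⟫ * ⟪p.1.2, p.2.2⟫) / Δ p
  let B : (E3 × E3) × (E3 × E3) → ℝ := fun p =>
    (⟪p.2.2, x - p.2.1⟫ * ‖p.1.2‖ ^ 2 - ⟪p.1.2, x - p.1.1⟫ * ⟪p.1.2, p.2.2⟫) / Δ p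
  let F : (E3 × E3) × (E3 × E3) → E3 := fun p => x - A p • p.1.2 - B p • p.2.2
  have hΔ0 : 0 < Δ ((y, n), (y', n')) := by simp only [Δ]; unfold Indep at h; linarith
  have hΔ : Continuous Δ := by simp only [Δ]; fun_prop
  have hF : ContinuousAt F ((y, n), (y', n')) := by
    have := hΔ0.ne'
    have := hΔ.continuousAt (x := ((y, n), (y', n')))
    simp only [F, A, B]
    fun_prop (disch := assumption)
  have hF0 : F ((y, n), (y', n')) = x := by simp [F, A, B, h1, h2]
  filter_upwards [hF.eventually (isOpen_interior.mem_nhds (by rwa [hF0])),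
    hΔ.continuousAt.eventually (lt_mem_nhds hΔ0)] with p hp1 hp2
  refine ⟨by simp only [Δ] at hp2; unfold Indep; linarith, F p, hp1, ?_, ?_⟩
  · rw [mem_planeAt,
      show F p - p.1.1 = (x - p.1.1) - A p • p.1.2 - B p • p.2.2 by simp only [F]; abel,
      inner_sub_right, inner_sub_right, real_inner_smul_right, real_inner_smul_right,
      real_inner_self_eq_norm_sq]
    simp only [A, B]
    have := hp2.ne'
    field_simp
    simp only [Δ]; ring
  · rw [mem_planeAt,
      show F p - p.2.1 = (x - p.2.1) - A p • p.1.2 - B p • p.2.2 by simp only [F]; abel,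
      inner_sub_right, inner_sub_right, real_inner_smul_right, real_inner_smul_right,
      real_inner_self_eq_norm_sq, real_inner_comm p.1.2 p.2.2]
    simp only [A, B]
    have := hp2.ne'
    field_simp
    simp only [Δ]; ring

theorem norm_sq_affine_identity (b w m : E3) (ρ s t : ℝ) (hs : s ≠ 0)
    (h : ‖b + s • w - m‖ ^ 2 = ρ) :
    ‖b + t • w - m‖ ^ 2 - ρ = (t - s) * ((ρ - ‖b - m‖ ^ 2) / s + t * ‖w‖ ^ 2) := by
  have e : ∀ t : ℝ, ‖b + t • w - m‖ ^ 2 = ‖b - m‖ ^ 2 + 2 * t * ⟪b - m, w⟫ + t ^ 2 * ‖w‖ ^ 2 := by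
    intro t
    rw [show b + t • w - m = (b - m) + t • w by abel, norm_add_sq_real, real_inner_smul_right,
      norm_smul, mul_pow, Real.norm_eq_abs, sq_abs]; ring
  rw [e] at h ⊢
  have : ⟪b - m, w⟫ = (ρ - ‖b - m‖ ^ 2 - s ^ 2 * ‖w‖ ^ 2) / (2 * s) := by field_simp; linarith
  rw [this]; field_simp; ring

/-- On a line through an interior point whose frontier points are on a sphere, the body
coincides with the ball. -/
theorem line_disc (hK : IsCompact K) (hc : Convex ℝ K) {b x m : E3} {ρ : ℝ} (hb : b ∈ interior K)
    (hxb : x ≠ b) (h : ∀ t : ℝ, b + t • (x - b) ∈ frontier K → ‖b + t • (x - b) - m‖ ^ 2 = ρ) :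
    ‖b - m‖ ^ 2 < ρ ∧ (x ∈ K ↔ ‖x - m‖ ^ 2 ≤ ρ) ∧ (x ∈ interior K ↔ ‖x - m‖ ^ 2 < ρ) := by
  have hv : x - b ≠ 0 := sub_ne_zero.2 hxb
  have hw : 0 < ‖x - b‖ ^ 2 := by positivity
  obtain ⟨s, hs, h1, h2, h3⟩ := exists_exit hK hc hb hv
  obtain ⟨r, hr, h1', -, -⟩ := exists_exit hK hc hb (neg_ne_zero.2 hv)
  have e1 := h s h1
  have e2 : ‖b + (-r) • (x - b) - m‖ ^ 2 = ρ := by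
    have : b + r • -(x - b) = b + (-r) • (x - b) := by module
    rw [this] at h1'
    exact h _ h1'
  have hB : ‖b - m‖ ^ 2 < ρ := by
    have := norm_sq_affine_identity b (x - b) m ρ s (-r) hs.ne' e1
    rw [e2, sub_self] at this
    have h4 := (mul_eq_zero.1 this.symm).resolve_left (by linarith)
    have h5 : 0 < (ρ - ‖b - m‖ ^ 2) / s := by
      have : 0 < r * ‖x - b‖ ^ 2 := by positivity
      linarith
    have := (div_pos_iff_of_pos_right hs).1 h5
    linarith
  have key := norm_sq_affine_identity b (x - b) m ρ s 1 hs.ne' e1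
  have hpos : 0 < (ρ - ‖b - m‖ ^ 2) / s + 1 * ‖x - b‖ ^ 2 := by
    have : 0 < (ρ - ‖b - m‖ ^ 2) / s := div_pos (by linarith) hs
    linarith
  rw [one_smul, add_sub_cancel] at key
  have k1 : ‖x - m‖ ^ 2 ≤ ρ ↔ 1 ≤ s := by
    rw [← sub_nonpos, key]
    constructor
    · intro h; by_contra h'
      have := mul_pos (sub_pos.2 (not_le.1 h')) hpos
      linarith
    · intro h; exact mul_nonpos_of_nonpos_of_nonneg (by linarith) hpos.le
  have k2 : ‖x - m‖ ^ 2 < ρ ↔ 1 < s := by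
    rw [← sub_neg, key]
    constructor
    · intro h; by_contra h'
      have : 0 ≤ (1 - s) := by linarith [not_lt.1 h']
      have := mul_nonneg this hpos.le
      linarith
    · intro h; exact mul_neg_of_neg_of_pos (by linarith) hpos
  have hx1 : b + (1 : ℝ) • (x - b) = x := by rw [one_smul, add_sub_cancel]
  refine ⟨hB, ?_, ?_⟩
  · rw [k1]
    constructor
    · intro h; by_contra h'
      exact h3 1 (not_le.1 h') (by rwa [hx1])
    · intro h
      rcases eq_or_lt_of_le h with rfl | h
      · rw [← hx1]; exact ((mem_frontier_iff' hK).1 h1).1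
      · rw [← hx1]; exact interior_subset (h2 1 zero_le_one h)
  · rw [k2]
    constructor
    · intro h; by_contra h'
      rcases eq_or_lt_of_le (not_lt.1 h') with rfl | h'
      · rw [hx1] at h1; exact ((mem_frontier_iff' hK).1 h1).2 h
      · exact h3 1 h' (by rw [hx1]; exact interior_subset h)
    · intro h
      rw [← hx1]; exact h2 1 zero_le_one h

/-- A plane section through the interior whose relative boundary lies on a sphere is a disc. -/
theorem plane_disc (hK : IsCompact K) (hc : Convex ℝ K) {b y n m : E3} {ρ : ℝ}
    (hb : b ∈ interior K) (hbp : b ∈ planeAt y n) (h : OnSphere (frontier K ∩ planeAt y n) m ρ)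
    {x : E3} (hx : x ∈ planeAt y n) :
    (x ∈ K ↔ ‖x - m‖ ^ 2 ≤ ρ) ∧ (x ∈ interior K ↔ ‖x - m‖ ^ 2 < ρ) ∧
      (x ∈ frontier K ↔ ‖x - m‖ ^ 2 = ρ) := by
  have main : (x ∈ K ↔ ‖x - m‖ ^ 2 ≤ ρ) ∧ (x ∈ interior K ↔ ‖x - m‖ ^ 2 < ρ) := by
    by_cases hxb : x = b
    · obtain ⟨d, hd, hnd, -⟩ := exists_orthogonal n n
      have := (line_disc hK hc (x := b + d) (m := m) (ρ := ρ) hb (by simpa using hd)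
        (fun t ht => h _ ⟨ht, add_smul_mem_planeAt hbp (by simpa using hnd) t⟩)).1
      subst hxb
      exact ⟨⟨fun _ => this.le, fun _ => interior_subset hb⟩, ⟨fun _ => this, fun _ => hb⟩⟩
    · exact (line_disc hK hc hb hxb (fun t ht => h _ ⟨ht, add_smul_mem_planeAt hbp
        (inner_sub_eq_zero_of_mem hx hbp) t⟩)).2
  refine ⟨main.1, main.2, ?_⟩
  rw [mem_frontier_iff' hK, main.1, main.2, not_lt]
  exact ⟨fun h => le_antisymm h.1 h.2, fun h => ⟨h.le, h.ge⟩⟩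

/-- The center of a cospherical section may be moved into the plane. -/
theorem OnSphere.project {A : Set E3} {y n m : E3} {ρ : ℝ} (hA : A ⊆ planeAt y n) (hn : n ≠ 0)
    (h : OnSphere A m ρ) : ∃ (k ρ' : ℝ), m - k • n ∈ planeAt y n ∧ OnSphere A (m - k • n) ρ' := by
  have hn' : ‖n‖ ^ 2 ≠ 0 := by simpa using hn
  let k := ⟪n, m - y⟫ / ‖n‖ ^ 2
  have hk : m - k • n ∈ planeAt y n := by
    rw [mem_planeAt, sub_right_comm, inner_sub_right, real_inner_smul_right,
      real_inner_self_eq_norm_sq, div_mul_cancel₀ _ hn', sub_self]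
  refine ⟨k, ρ - k ^ 2 * ‖n‖ ^ 2, hk, fun x hx => ?_⟩
  have h1 := h x hx
  have h2 : ⟪n, x - (m - k • n)⟫ = 0 := inner_sub_eq_zero_of_mem (hA hx) hk
  rw [show x - m = (x - (m - k • n)) - k • n by abel, norm_sub_sq_real, real_inner_smul_right,
    real_inner_comm, h2, norm_smul, mul_pow, Real.norm_eq_abs, sq_abs] at h1
  linarith

/-- A support functional at a point of a circular section is a combination of the normal of the
plane and of the radius. -/
theorem support_eq_combination (hK : IsCompact K) (hc : Convex ℝ K) {b y n m c ν : E3} {ρ : ℝ}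
    (hn : n ≠ 0) (hb : b ∈ interior K) (hbp : b ∈ planeAt y n)
    (h : OnSphere (frontier K ∩ planeAt y n) m ρ) (hcf : c ∈ frontier K) (hcp : c ∈ planeAt y n)
    (hν : ∀ x ∈ K, ⟪ν, x - c⟫ ≤ 0) : ∃ a b : ℝ, ν = a • n + b • (c - m) := by
  have hn' : ‖n‖ ^ 2 ≠ 0 := by simpa using hn
  obtain ⟨k, ρ', hm', h'⟩ := h.project Set.inter_subset_right hn
  set m' := m - k • n with hm'def
  set q := ν - (⟪n, ν⟫ / ‖n‖ ^ 2) • n with hq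
  have hnq : ⟪n, q⟫ = 0 := by
    rw [hq, inner_sub_right, real_inner_smul_right, real_inner_self_eq_norm_sq,
      div_mul_cancel₀ _ hn', sub_self]
  have hνq : ν = q + (⟪n, ν⟫ / ‖n‖ ^ 2) • n := by rw [hq]; abel
  have hinner : ∀ w, ⟪n, w⟫ = 0 → ⟪ν, w⟫ = ⟪q, w⟫ := by
    intro w hw
    nth_rewrite 1 [hνq]
    rw [inner_add_left, real_inner_smul_left, hw]; simp
  have hcm : ⟪n, c - m'⟫ = 0 := inner_sub_eq_zero_of_mem hcp hm'
  have hρ : ‖c - m'‖ ^ 2 = ρ' := h' c ⟨hcf, hcp⟩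
  suffices ∃ l : ℝ, q = l • (c - m') by
    obtain ⟨l, hl⟩ := this
    refine ⟨⟪n, ν⟫ / ‖n‖ ^ 2 + l * k, l, ?_⟩
    rw [hνq, hl, hm'def, inner_add_right, real_inner_smul_right, real_inner_smul_right,
      real_inner_self_eq_norm_sq, ← hm'def, hcm, hm'def]
    rw [mul_zero, zero_add, div_mul_cancel₀ _ hn']
    module
  by_cases hq0 : q = 0
  · exact ⟨0, by simp [hq0]⟩
  have hqn : ‖q‖ ≠ 0 := by simpa using hq0
  set x := m' + (‖c - m'‖ / ‖q‖) • q with hx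
  have hxp : x ∈ planeAt y n := add_smul_mem_planeAt hm' hnq _
  have hxm : x - m' = (‖c - m'‖ / ‖q‖) • q := by rw [hx]; abel
  have hxK : x ∈ K := by
    rw [(plane_disc hK hc hb hbp h' hxp).1, hxm, norm_smul, Real.norm_of_nonneg (by positivity),
      div_mul_cancel₀ _ hqn, hρ]
  have h1 := hν x hxK
  rw [hinner _ (inner_sub_eq_zero_of_mem hxp hcp), show x - c = (x - m') - (c - m') by abel,
    inner_sub_right, hxm, real_inner_smul_right, real_inner_self_eq_norm_sq] at h1
  have h2 : ‖c - m'‖ / ‖q‖ * ‖q‖ ^ 2 = ‖c - m'‖ * ‖q‖ := by field_simp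
  rw [h2] at h1
  have hcm0 : c - m' ≠ 0 := by
    intro h0
    have := (plane_disc hK hc hb hbp h' hbp).2.1.1 hb
    rw [h0, norm_zero] at hρ
    have := sq_nonneg ‖b - m'‖
    linarith
  have h3 : ¬ Indep (c - m') q := by
    unfold Indep
    rw [not_lt, ← mul_pow, real_inner_comm]
    exact pow_le_pow_left₀ (by positivity) (by linarith) 2
  exact exists_smul_of_not_indep hcm0 h3

theorem exists_support (hK : IsCompact K) (hc : Convex ℝ K) {c : E3} (hcf : c ∈ frontier K)
    (hne : (interior K).Nonempty) :
    ∃ ν : E3, (∀ x ∈ K, ⟪ν, x - c⟫ ≤ 0) ∧ ∀ x ∈ interior K, ⟪ν, x - c⟫ < 0 := by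
  obtain ⟨f, hf⟩ := geometric_hahn_banach_open_point hc.interior isOpen_interior
    ((mem_frontier_iff' hK).1 hcf).2
  have hrep : ∀ x, f x = ⟪(InnerProductSpace.toDual ℝ E3).symm f, x⟫ := fun x => by simp
  refine ⟨(InnerProductSpace.toDual ℝ E3).symm f, fun x hx => ?_, fun x hx => ?_⟩
  · rw [inner_sub_right, ← hrep, ← hrep, sub_nonpos]
    have hcl : K ⊆ closure (interior K) := by
      rw [hc.closure_interior_eq_closure_of_nonempty_interior hne]; exact subset_closure
    exact closure_minimal (fun z hz => (hf z hz).le)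
      (isClosed_le f.continuous continuous_const) (hcl hx)
  · rw [inner_sub_right, ← hrep, ← hrep]
    linarith [hf x hx]

/-- A function affine in `x` arising as difference of two power functions. -/
theorem power_diff (x x₀ m m' : E3) :
    ‖x - m‖ ^ 2 - ‖x - m'‖ ^ 2 =
      ‖x₀ - m‖ ^ 2 - ‖x₀ - m'‖ ^ 2 + 2 * ⟪m' - m, x - x₀⟫ := by
  rw [show x - m = (x - x₀) + (x₀ - m) by abel, show x - m' = (x - x₀) + (x₀ - m') by abel,
    norm_add_sq_real, norm_add_sq_real, show m' - m = (x₀ - m) - (x₀ - m') by abel,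
    real_inner_comm (x - x₀) (x₀ - m - (x₀ - m')), inner_sub_right (x - x₀) (x₀ - m)]
  ring

/-- Two cospherical crossing sections: the powers agree on the common line. -/
theorem power_eq_on_line (hK : IsCompact K) (hc : Convex ℝ K) {x d m m' : E3} {ρ ρ' : ℝ}
    (hx : x ∈ interior K) (hd : d ≠ 0)
    (h : ∀ t : ℝ, x + t • d ∈ frontier K → ‖x + t • d - m‖ ^ 2 = ρ)
    (h' : ∀ t : ℝ, x + t • d ∈ frontier K → ‖x + t • d - m'‖ ^ 2 = ρ') :
    ⟪m' - m, d⟫ = 0 ∧ ‖x - m‖ ^ 2 - ρ = ‖x - m'‖ ^ 2 - ρ' := by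
  obtain ⟨s, hs, h1, -, -⟩ := exists_exit hK hc hx hd
  obtain ⟨r, hr, h2, -, -⟩ := exists_exit hK hc hx (neg_ne_zero.2 hd)
  rw [smul_neg, ← neg_smul] at h2
  have e1 := power_diff (x + s • d) x m m'
  have e2 := power_diff (x + (-r) • d) x m m'
  rw [add_sub_cancel_left, real_inner_smul_right, h s h1, h' s h1] at e1
  rw [add_sub_cancel_left, real_inner_smul_right, h _ h2, h' _ h2] at e2
  have h0 : ⟪m' - m, d⟫ = 0 := by
    have : (s + r) * ⟪m' - m, d⟫ = 0 := by linarith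
    exact (mul_eq_zero.1 this).resolve_left (by positivity)
  rw [h0] at e1
  exact ⟨h0, by linarith⟩

/-- Two crossing cospherical sections lie on a common sphere. -/
theorem exists_common_sphere (hK : IsCompact K) (hc : Convex ℝ K) {y n m y' n' m' : E3} {ρ ρ' : ℝ}
    (hX : Crossing K y n y' n') (h : OnSphere (frontier K ∩ planeAt y n) m ρ)
    (h' : OnSphere (frontier K ∩ planeAt y' n') m' ρ') :
    ∃ M R, OnSphere (frontier K ∩ planeAt y n) M R ∧ OnSphere (frontier K ∩ planeAt y' n') M R := by
  obtain ⟨hi, x, hx, hx1, hx2⟩ := hX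
  obtain ⟨d, hd, hd1, hd2⟩ := exists_orthogonal n n'
  obtain ⟨hg, hp⟩ := power_eq_on_line hK hc hx hd
    (fun t ht => h _ ⟨ht, add_smul_mem_planeAt hx1 hd1 t⟩)
    (fun t ht => h' _ ⟨ht, add_smul_mem_planeAt hx2 hd2 t⟩)
  obtain ⟨a, b, hab⟩ := exists_combination hd (by rwa [real_inner_comm])
    (by rwa [real_inner_comm]) (by rwa [real_inner_comm] at hg) hi
  refine ⟨m + a • n, ρ - 2 * a * ⟪n, x - m⟫ + ‖a • n‖ ^ 2, ?_, ?_⟩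
  · rintro z ⟨hz, hzp⟩
    have h0 : ⟪n, z - x⟫ = 0 := inner_sub_eq_zero_of_mem hzp hx1
    have := h z ⟨hz, hzp⟩
    rw [← sub_sub, norm_sub_sq_real, this, real_inner_smul_right, real_inner_comm,
      show z - m = (z - x) + (x - m) by abel, inner_add_right, h0]
    ring
  · rintro z ⟨hz, hzp⟩
    have h0 : ⟪n', z - x⟫ = 0 := inner_sub_eq_zero_of_mem hzp hx2
    have e1 := h' z ⟨hz, hzp⟩
    have e2 := power_diff z x m m'
    rw [hab, inner_add_left, real_inner_smul_left, real_inner_smul_left, h0] at e2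
    rw [← sub_sub, norm_sub_sq_real, real_inner_smul_right, real_inner_comm n (z - m)]
    have e3 : ⟪n, z - m⟫ = ⟪n, z - x⟫ + ⟪n, x - m⟫ := by
      rw [← inner_add_right]; congr 1; abel
    rw [e3]
    linarith

/-- A cospherical section crossing two different sections of a sphere lies on that sphere. -/
theorem onSphere_of_crossing (hK : IsCompact K) (hc : Convex ℝ K)
    {y₁ n₁ y₂ n₂ y₃ n₃ m m₃ : E3} {ρ ρ₃ : ℝ}
    (h₁ : OnSphere (frontier K ∩ planeAt y₁ n₁) m ρ)
    (h₂ : OnSphere (frontier K ∩ planeAt y₂ n₂) m ρ)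
    (h₃ : OnSphere (frontier K ∩ planeAt y₃ n₃) m₃ ρ₃)
    (h₃₁ : Crossing K y₃ n₃ y₁ n₁) (h₃₂ : Crossing K y₃ n₃ y₂ n₂)
    (hne : planeAt y₁ n₁ ≠ planeAt y₂ n₂) :
    OnSphere (frontier K ∩ planeAt y₃ n₃) m ρ := by
  obtain ⟨hi1, x1, hx1, hx13, hx11⟩ := h₃₁
  obtain ⟨hi2, x2, hx2, hx23, hx22⟩ := h₃₂
  obtain ⟨d1, hd1, hd13, hd11⟩ := exists_orthogonal n₃ n₁
  obtain ⟨d2, hd2, hd23, hd22⟩ := exists_orthogonal n₃ n₂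
  obtain ⟨hg1, hp1⟩ := power_eq_on_line hK hc hx1 hd1
    (fun t ht => h₁ _ ⟨ht, add_smul_mem_planeAt hx11 hd11 t⟩)
    (fun t ht => h₃ _ ⟨ht, add_smul_mem_planeAt hx13 hd13 t⟩)
  obtain ⟨hg2, hp2⟩ := power_eq_on_line hK hc hx2 hd2
    (fun t ht => h₂ _ ⟨ht, add_smul_mem_planeAt hx22 hd22 t⟩)
    (fun t ht => h₃ _ ⟨ht, add_smul_mem_planeAt hx23 hd23 t⟩)
  have hg3 : ⟪m₃ - m, x2 - x1⟫ = 0 := by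
    have := power_diff x2 x1 m m₃
    linarith
  have hn3 := hi1.ne_left
  suffices hmain : ∀ w, ⟪n₃, w⟫ = 0 → ⟪m₃ - m, w⟫ = 0 by
    rintro z ⟨hz, hzp⟩
    have e1 := h₃ z ⟨hz, hzp⟩
    have e2 := power_diff z x1 m m₃
    rw [hmain _ (inner_sub_eq_zero_of_mem hzp hx13)] at e2
    linarith
  have span : ∀ e, ⟪n₃, e⟫ = 0 → ⟪m₃ - m, e⟫ = 0 → Indep d1 e →
      ∀ w, ⟪n₃, w⟫ = 0 → ⟪m₃ - m, w⟫ = 0 := by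
    intro e he hge hi w hw
    obtain ⟨a, b, rfl⟩ := exists_combination hn3 hd13 he hw hi
    rw [inner_add_right, real_inner_smul_right, real_inner_smul_right, hg1, hge]; ring
  by_cases c1 : Indep d1 d2
  · exact span d2 hd23 hg2 c1
  by_cases c2 : Indep d1 (x2 - x1)
  · exact span _ (inner_sub_eq_zero_of_mem hx23 hx13) hg3 c2
  obtain ⟨k, hk⟩ := exists_smul_of_not_indep hd1 c1
  obtain ⟨j, hj⟩ := exists_smul_of_not_indep hd1 c2
  have hk0 : k ≠ 0 := by rintro rfl; exact hd2 (by simpa using hk)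
  have hd12 : ⟪n₂, d1⟫ = 0 := by
    rw [hk, real_inner_smul_right] at hd22
    exact (mul_eq_zero.1 hd22).resolve_left hk0
  have hx12 : x1 ∈ planeAt y₂ n₂ := by
    have : x1 = x2 + (-j) • d1 := by rw [neg_smul, ← hj]; abel
    rw [this]; exact add_smul_mem_planeAt hx22 hd12 _
  have hi12 : Indep n₁ n₂ := by
    refine indep_of_eq_zero hi1.ne_right fun l hl => hne ?_
    have hl0 : l ≠ 0 := by rintro rfl; exact hi2.ne_right (by simpa using hl)
    rw [planeAt_congr hx11, planeAt_congr hx12, hl, planeAt_smul _ _ hl0]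
  obtain ⟨s, hs, hcf, -, -⟩ := exists_exit hK hc hx1 hd1
  set c := x1 + s • d1 with hcdef
  obtain ⟨ν, hν, hνi⟩ := exists_support hK hc hcf ⟨x1, hx1⟩
  have hνd : ⟪ν, d1⟫ ≠ 0 := by
    have := hνi x1 hx1
    rw [hcdef, sub_add_cancel_left, inner_neg_right, real_inner_smul_right] at this
    intro h0
    rw [h0] at this; linarith
  have hc1 : c ∈ planeAt y₁ n₁ := add_smul_mem_planeAt hx11 hd11 _
  have hc2 : c ∈ planeAt y₂ n₂ := add_smul_mem_planeAt hx12 hd12 _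
  have hc3 : c ∈ planeAt y₃ n₃ := add_smul_mem_planeAt hx13 hd13 _
  obtain ⟨a1, b1, e1⟩ := support_eq_combination hK hc hi1.ne_right hx1 hx11 h₁ hcf hc1 hν
  obtain ⟨a2, b2, e2⟩ := support_eq_combination hK hc hi2.ne_right hx1 hx12 h₂ hcf hc2 hν
  obtain ⟨a3, b3, e3⟩ := support_eq_combination hK hc hn3 hx1 hx13 h₃ hcf hc3 hν
  have f1 : ⟪ν, d1⟫ = b1 * ⟪c - m, d1⟫ := by
    rw [e1, inner_add_left, real_inner_smul_left, real_inner_smul_left, hd11]; ring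
  have f2 : ⟪ν, d1⟫ = b2 * ⟪c - m, d1⟫ := by
    rw [e2, inner_add_left, real_inner_smul_left, real_inner_smul_left, hd12]; ring
  have f3 : ⟪ν, d1⟫ = b3 * ⟪c - m, d1⟫ := by
    have : ⟪c - m₃, d1⟫ = ⟪c - m, d1⟫ := by
      rw [← sub_eq_zero, ← inner_sub_left, show c - m₃ - (c - m) = -(m₃ - m) by abel,
        inner_neg_left, hg1, neg_zero]
    rw [e3, inner_add_left, real_inner_smul_left, real_inner_smul_left, hd13, this]; ring
  have hcd : ⟪c - m, d1⟫ ≠ 0 := by intro h0; rw [f1, h0, mul_zero] at hνd; exact hνd rfl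
  have g1 : b2 = b1 := mul_right_cancel₀ hcd (by linarith)
  have g2 : b3 = b1 := mul_right_cancel₀ hcd (by linarith)
  subst g1 g2
  have hb0 : b3 ≠ 0 := by rintro rfl; rw [f1, zero_mul] at hνd; exact hνd rfl
  have ha := (hi12.eq_zero (a := a1) (b := -a2) (by
    rw [neg_smul, ← sub_eq_add_neg, sub_eq_zero]
    exact add_right_cancel (e1.symm.trans e2))).1
  rw [ha, zero_smul, zero_add] at e1
  have hfin : b3 • (m₃ - m) = a3 • n₃ := by
    have := e1.symm.trans e3
    linear_combination (norm := module) this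
  intro w hw
  have : b3 * ⟪m₃ - m, w⟫ = 0 := by
    rw [← real_inner_smul_left, hfin, real_inner_smul_left, hw, mul_zero]
  exact (mul_eq_zero.1 this).resolve_left hb0

end Body

/-- The section of `frontier K` by the plane through `y` orthogonal to `n` is cospherical, with
center in `K`. -/
def CosphericalSection (K : Set E3) (y n : E3) : Prop :=
  ∃ m ∈ K, ∃ ρ, OnSphere (frontier K ∩ planeAt y n) m ρ

/-- A convex body together with a continuous field of unit directions along its boundary, whose
lines enter the body and meet only in its interior. -/
structure LineField (K : Set E3) (U : E3 → E3) : Prop where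
  compact : IsCompact K
  convex : Convex ℝ K
  cont : ContinuousOn U (frontier K)
  norm_eq : ∀ y ∈ frontier K, ‖U y‖ = 1
  inward : ∀ y ∈ frontier K, ∃ s : ℝ, 0 < s ∧ y - s • U y ∈ interior K
  meet : ∀ y ∈ frontier K, ∀ z ∈ frontier K, ∀ s t : ℝ, y + s • U y = z + t • U z →
    y + s • U y ∈ interior K ∨ ∃ k : ℝ, z = y + k • U y ∧ (U z = U y ∨ U z = -U y)
  parallel : ∀ y ∈ frontier K, ∀ z ∈ frontier K, (U z = U y ∨ U z = -U y) →
    ∃ k : ℝ, z = y + k • U y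

/-- Unit normals of the planes containing the line at `y` whose section is cospherical. -/
def Admissible (K : Set E3) (U : E3 → E3) (y n : E3) : Prop :=
  ‖n‖ = 1 ∧ ⟪n, U y⟫ = 0 ∧ CosphericalSection K y n

/-- Near some boundary point, all admissible sections lie on one sphere. -/
def LocallySpherical (K : Set E3) (U : E3 → E3) : Prop :=
  ∃ m ρ, ∃ c ∈ frontier K, ∀ᶠ y in 𝓝 c, y ∈ frontier K → ∀ n, Admissible K U y n →
    OnSphere (frontier K ∩ planeAt y n) m ρ

theorem Indep.smul_left {u v : E3} (h : Indep u v) {k : ℝ} (hk : k ≠ 0) : Indep (k • u) v := by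
  unfold Indep at *
  rw [real_inner_smul_left, norm_smul, mul_pow, mul_pow, Real.norm_eq_abs, sq_abs, mul_assoc]
  exact mul_lt_mul_of_pos_left h (by positivity)

theorem planeAt_ne_of_indep {y n y' n' : E3} (h : Indep n n') : planeAt y n ≠ planeAt y' n' := by
  intro he
  obtain ⟨k, hk⟩ : ∃ k : ℝ, n' = k • n := by
    refine exists_smul_of_not_indep h.ne_left fun hi => ?_
    have hyy : y ∈ planeAt y' n' := he ▸ self_mem_planeAt y n
    obtain ⟨d, hd, hd1, -⟩ := exists_orthogonal n n
    have hn : ‖n‖ ^ 2 ≠ 0 := by simpa using h.ne_left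
    set w := n' - (⟪n, n'⟫ / ‖n‖ ^ 2) • n with hw
    have hnw : ⟪n, w⟫ = 0 := by
      rw [hw, inner_sub_right, real_inner_smul_right, real_inner_self_eq_norm_sq,
        div_mul_cancel₀ _ hn, sub_self]
    have h1 : y + (1 : ℝ) • w ∈ planeAt y' n' :=
      he ▸ add_smul_mem_planeAt (self_mem_planeAt y n) hnw 1
    have h2 : ⟪n', w⟫ = 0 := by
      have := inner_sub_eq_zero_of_mem h1 hyy
      simpa using this
    have h3 : ⟪w, w⟫ = 0 := by
      nth_rewrite 1 [hw]
      rw [inner_sub_left, h2, real_inner_smul_left, hnw]; simp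
    rw [inner_self_eq_zero] at h3
    rw [hw, sub_eq_zero] at h3
    rw [h3] at h
    exact not_indep_smul _ _ h
  rw [hk] at h
  exact not_indep_smul _ _ h

theorem Crossing.planeAt_ne {K : Set E3} {y n y' n' : E3} (h : Crossing K y n y' n') :
    planeAt y n ≠ planeAt y' n' := planeAt_ne_of_indep h.1

theorem Crossing.eventually_left {K : Set E3} {y n y' n' : E3} (h : Crossing K y n y' n') :
    ∀ᶠ p in 𝓝 (y, n), Crossing K p.1 p.2 y' n' := by
  have hc : Continuous fun p : E3 × E3 => (p, (y', n')) := by fun_prop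
  exact hc.continuousAt.eventually h.eventually

theorem crossing_or_planeAt_eq {K : Set E3} {y n y' n' q : E3} (hn : n ≠ 0) (hn' : n' ≠ 0)
    (hq : q ∈ interior K) (h : q ∈ planeAt y n) (h' : q ∈ planeAt y' n') :
    Crossing K y n y' n' ∨ planeAt y n = planeAt y' n' := by
  by_cases hi : Indep n n'
  · exact Or.inl ⟨hi, q, hq, h, h'⟩
  · obtain ⟨k, rfl⟩ := exists_smul_of_not_indep hn hi
    have hk : k ≠ 0 := by rintro rfl; simp at hn'
    right
    rw [planeAt_congr h, planeAt_congr h', planeAt_smul _ _ hk]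

/-- A line through a point outside the interior enters the interior on one side only. -/
theorem neg_of_mem_interior {K : Set E3} (hc : Convex ℝ K) {y v : E3} (hy : y ∉ interior K)
    {s t : ℝ} (hs : 0 < s) (hs' : y - s • v ∈ interior K) (ht : y + t • v ∈ interior K) : t < 0 := by
  by_contra h
  rw [not_lt] at h
  have := hc.interior hs' ht (a := t / (s + t)) (b := s / (s + t)) (by positivity)
    (by positivity) (by field_simp; ring)
  refine hy ?_
  convert this using 1
  have h1 : s + t ≠ 0 := by positivity
  match_scalars <;> field_simp
  · ring
  · ring

namespace LineField

variable {K : Set E3} {U : E3 → E3}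

theorem exists_interior_mem_planeAt (F : LineField K U) {y n : E3} (hy : y ∈ frontier K)
    (hn : ⟪n, U y⟫ = 0) : ∃ b ∈ interior K, b ∈ planeAt y n := by
  obtain ⟨s, -, hs⟩ := F.inward y hy
  refine ⟨_, hs, ?_⟩
  rw [sub_eq_add_neg, ← neg_smul]
  exact add_smul_mem_planeAt (self_mem_planeAt y n) hn _

theorem neg_of_mem_interior (F : LineField K U) {y : E3} (hy : y ∈ frontier K) {t : ℝ}
    (ht : y + t • U y ∈ interior K) : t < 0 := by
  obtain ⟨s, hs, hs'⟩ := F.inward y hy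
  exact _root_.neg_of_mem_interior F.convex ((mem_frontier_iff' F.compact).1 hy).2 hs hs' ht

theorem isClosed_admissible (F : LineField K U) :
    IsClosed {p : E3 × E3 | p.1 ∈ frontier K ∧ Admissible K U p.1 p.2} := by
  rw [isClosed_iff_ultrafilter]
  rintro ⟨a, n⟩ G hG hmem
  have hGa : Tendsto (fun p : E3 × E3 => p.1) (G : Filter (E3 × E3)) (𝓝 a) :=
    (continuous_fst.tendsto (a, n)).mono_left hG
  have hGn : Tendsto (fun p : E3 × E3 => p.2) (G : Filter (E3 × E3)) (𝓝 n) :=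
    (continuous_snd.tendsto (a, n)).mono_left hG
  have ha : a ∈ frontier K :=
    isClosed_frontier.mem_of_tendsto hGa (mem_of_superset hmem fun p hp => hp.1)
  have hGU : Tendsto (fun p : E3 × E3 => U p.1) (G : Filter (E3 × E3)) (𝓝 (U a)) :=
    (F.cont a ha).tendsto.comp (tendsto_nhdsWithin_iff.2
      ⟨hGa, mem_of_superset hmem fun p hp => hp.1⟩)
  have hn1 : ‖n‖ = 1 :=
    tendsto_nhds_unique (hGn.norm.congr' (mem_of_superset hmem fun p hp => hp.2.1))
      tendsto_const_nhds
  have hnU : ⟪n, U a⟫ = 0 :=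
    tendsto_nhds_unique ((hGn.inner hGU).congr' (mem_of_superset hmem fun p hp => hp.2.2.1))
      tendsto_const_nhds
  refine ⟨ha, hn1, hnU, ?_⟩
  have hex : ∀ p : E3 × E3, ∃ m : E3, (p.1 ∈ frontier K ∧ Admissible K U p.1 p.2) →
      m ∈ K ∧ ∀ x ∈ frontier K ∩ planeAt p.1 p.2, ‖x - m‖ ^ 2 = ‖p.1 - m‖ ^ 2 := by
    intro p
    by_cases hp : p.1 ∈ frontier K ∧ Admissible K U p.1 p.2
    · obtain ⟨m, hm, ρ, h⟩ := hp.2.2.2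
      exact ⟨m, fun _ => ⟨hm, fun x hx => by rw [h x hx, h _ ⟨hp.1, self_mem_planeAt _ _⟩]⟩⟩
    · exact ⟨0, fun h => absurd h hp⟩
  choose m hm using hex
  obtain ⟨M, hM, hlim⟩ := F.compact.ultrafilter_le_nhds (G.map m) (by
    rw [le_principal_iff]
    have : m ⁻¹' K ∈ (G : Filter (E3 × E3)) := mem_of_superset hmem fun p hp => (hm p hp).1
    exact this)
  have hlim' : Tendsto m (G : Filter (E3 × E3)) (𝓝 M) := hlim
  refine ⟨M, hM, ‖a - M‖ ^ 2, ?_⟩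
  rintro x ⟨hx, hxp⟩
  obtain ⟨b, hb, hbp⟩ := F.exists_interior_mem_planeAt ha hnU
  have hn0 : n ≠ 0 := by rintro rfl; simp at hn1
  by_contra hne
  have hcont : Continuous fun q : (E3 × E3) × E3 => ‖q.1.1 - q.1.2‖ ^ 2 - ‖q.2 - q.1.2‖ ^ 2 := by
    fun_prop
  have hev : ∀ᶠ q in 𝓝 ((x, M), a), ‖q.1.1 - q.1.2‖ ^ 2 - ‖q.2 - q.1.2‖ ^ 2 ≠ 0 :=
    hcont.continuousAt.eventually_ne (by simpa [sub_eq_zero] using hne)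
  rw [nhds_prod_eq, nhds_prod_eq, Filter.eventually_prod_iff] at hev
  obtain ⟨pa, hpa, pb, hpb, hab⟩ := hev
  rw [Filter.eventually_prod_iff] at hpa
  obtain ⟨pc, hpc, pd, hpd, hcd⟩ := hpa
  have e1 := hG (eventually_exists_frontier F.compact F.convex hpc hx hxp hn0 hb hbp)
  have e2 := hlim'.eventually hpd
  have e3 := hGa.eventually hpb
  have e4 : ∀ᶠ p in (G : Filter (E3 × E3)), p.1 ∈ frontier K ∧ Admissible K U p.1 p.2 := hmem
  obtain ⟨p, ⟨x', hx', hx'f, hxn⟩, h2, h3, h4⟩ :=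
    (Filter.Eventually.and (f := (G : Filter (E3 × E3))) e1 (e2.and (e3.and e4))).exists
  exact hab (hcd hx' h2) h3 (by simpa [sub_eq_zero] using (hm p h4).2 x' ⟨hx'f, hxn⟩)

/-- A property that holds near all admissible planes at `a` holds for all admissible planes at
boundary points near `a`. -/
theorem eventually_forall_admissible (F : LineField K U) {a : E3}
    {Q : E3 → E3 → Prop} (h : ∀ n, a ∈ frontier K → Admissible K U a n →
      ∀ᶠ p in 𝓝 (a, n), p.1 ∈ frontier K → Admissible K U p.1 p.2 → Q p.1 p.2) :
    ∀ᶠ y in 𝓝 a, y ∈ frontier K → ∀ n, Admissible K U y n → Q y n := by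
  have h1 : ∀ n ∈ Metric.sphere (0 : E3) 1, ∀ᶠ p in 𝓝 (a, n),
      p.1 ∈ frontier K → Admissible K U p.1 p.2 → Q p.1 p.2 := by
    intro n _
    by_cases hn : a ∈ frontier K ∧ Admissible K U a n
    · exact h n hn.1 hn.2
    · filter_upwards [F.isClosed_admissible.isOpen_compl.mem_nhds
        (show (a, n) ∈ {p : E3 × E3 | p.1 ∈ frontier K ∧ Admissible K U p.1 p.2}ᶜ from hn)]
        with p hp h1 h2
      exact absurd ⟨h1, h2⟩ hp
  have h2 := (isCompact_sphere (0 : E3) 1).eventually_forall_of_forall_eventually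
    (P := fun y n => y ∈ frontier K → Admissible K U y n → Q y n) h1
  filter_upwards [h2] with y hy hyf n hn
  exact hy n (by simpa using hn.1) hyf hn

end LineField

/-- The section of `K` by the plane through `a` orthogonal to the unit vector `n` is the disc with
center `m` and squared radius `ρ`. -/
structure DiscSection (K : Set E3) (a n m : E3) (ρ : ℝ) : Prop where
  norm_eq : ‖n‖ = 1
  center : m ∈ planeAt a n
  pos : 0 < ρ
  interior_iff : ∀ x ∈ planeAt a n, (x ∈ interior K ↔ ‖x - m‖ ^ 2 < ρ)
  frontier_iff : ∀ x ∈ planeAt a n, (x ∈ frontier K ↔ ‖x - m‖ ^ 2 = ρ)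

theorem LineField.exists_discSection {K : Set E3} {U : E3 → E3} (F : LineField K U) {a n : E3}
    (ha : a ∈ frontier K) (hn : Admissible K U a n) : ∃ m ρ, DiscSection K a n m ρ := by
  obtain ⟨h1, h2, m, -, ρ, h⟩ := hn
  have hn0 : n ≠ 0 := by rintro rfl; simp at h1
  obtain ⟨k, ρ', hm, h'⟩ := h.project Set.inter_subset_right hn0
  obtain ⟨b, hb, hbp⟩ := F.exists_interior_mem_planeAt ha h2
  have key := fun x (hx : x ∈ planeAt a n) => plane_disc F.compact F.convex hb hbp h' hx
  refine ⟨_, ρ', h1, hm, ?_, fun x hx => (key x hx).2.1, fun x hx => (key x hx).2.2⟩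
  have := (key b hbp).2.1.1 hb
  have := sq_nonneg ‖b - (m - k • n)‖
  linarith

namespace DiscSection

variable {K : Set E3} {a n m : E3} {ρ : ℝ}

theorem ne_zero (D : DiscSection K a n m ρ) : n ≠ 0 := by
  rintro rfl; simpa using D.norm_eq

theorem inner_sub_center (D : DiscSection K a n m ρ) {c : E3} (hc : c ∈ planeAt a n) :
    ⟪n, c - m⟫ = 0 := inner_sub_eq_zero_of_mem hc D.center

/-- A tangent vector completing a radius to an orthogonal frame of the plane. -/
theorem exists_tangent (D : DiscSection K a n m ρ) (c : E3) :
    ∃ e : E3, ⟪n, e⟫ = 0 ∧ ⟪c - m, e⟫ = 0 ∧ ‖e‖ ^ 2 = ρ := by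
  obtain ⟨e, he, h1, h2⟩ := exists_orthogonal n (c - m)
  refine ⟨(√ρ / ‖e‖) • e, ?_, ?_, ?_⟩
  · rw [real_inner_smul_right, h1, mul_zero]
  · rw [real_inner_smul_right, h2, mul_zero]
  · have : ‖e‖ ≠ 0 := by simpa using he
    rw [norm_smul, Real.norm_of_nonneg (by positivity), div_mul_cancel₀ _ this,
      Real.sq_sqrt D.pos.le]

theorem circle_point_mem (D : DiscSection K a n m ρ) {c e : E3} (hc : c ∈ frontier K)
    (hcp : c ∈ planeAt a n) (h1 : ⟪n, e⟫ = 0) (h2 : ⟪c - m, e⟫ = 0) (h3 : ‖e‖ ^ 2 = ρ) (θ : ℝ) :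
    m + (Real.cos θ • (c - m) + Real.sin θ • e) ∈ frontier K ∩ planeAt a n := by
  have hp : m + (Real.cos θ • (c - m) + Real.sin θ • e) ∈ planeAt a n := by
    rw [← add_assoc]
    exact add_smul_mem_planeAt (add_smul_mem_planeAt D.center (D.inner_sub_center hcp) _) h1 _
  refine ⟨(D.frontier_iff _ hp).2 ?_, hp⟩
  have h4 := (D.frontier_iff c hcp).1 hc
  rw [add_sub_cancel_left, norm_add_sq_real, real_inner_smul_left, real_inner_smul_right, h2,
    norm_smul, norm_smul, mul_pow, mul_pow, h3, h4, Real.norm_eq_abs, Real.norm_eq_abs, sq_abs,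
    sq_abs]
  linear_combination ρ * Real.cos_sq_add_sin_sq θ

theorem neBot (D : DiscSection K a n m ρ) {c : E3} (hc : c ∈ frontier K) (hcp : c ∈ planeAt a n) :
    NeBot (𝓝[(frontier K ∩ planeAt a n) \ {c}] c) := by
  obtain ⟨e, h1, h2, h3⟩ := D.exists_tangent c
  have hcont : Continuous fun θ : ℝ => m + (Real.cos θ • (c - m) + Real.sin θ • e) := by fun_prop
  have ht : Tendsto (fun θ : ℝ => m + (Real.cos θ • (c - m) + Real.sin θ • e)) (𝓝[>] 0)
      (𝓝[(frontier K ∩ planeAt a n) \ {c}] c) := by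
    refine tendsto_nhdsWithin_iff.2 ⟨?_, ?_⟩
    · have := hcont.tendsto 0
      simp only [Real.cos_zero, one_smul, Real.sin_zero, zero_smul, add_zero,
        add_sub_cancel] at this
      exact this.mono_left nhdsWithin_le_nhds
    · filter_upwards [self_mem_nhdsWithin, nhdsWithin_le_nhds (eventually_lt_nhds Real.pi_pos)]
        with θ h0 hpi
      refine ⟨D.circle_point_mem hc hcp h1 h2 h3 θ, fun h => ?_⟩
      have h5 : Real.cos θ • (c - m) + Real.sin θ • e = c - m := by
        rw [Set.mem_singleton_iff] at h
        rw [eq_sub_iff_add_eq', h]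
      have h6 := congrArg (fun v => ⟪v, e⟫) h5
      simp only [inner_add_left, real_inner_smul_left, h2, real_inner_self_eq_norm_sq, h3] at h6
      have := mul_pos (Real.sin_pos_of_pos_of_lt_pi h0 hpi) D.pos
      linarith
  exact ht.neBot

end DiscSection

/-- The normal of the plane spanned by a direction `v` and the tangent at `c` of a circle with
center `m` in a plane with normal `n`. -/
noncomputable def tangentNormal (n m c v : E3) : E3 := (c - m) - (⟪v, c - m⟫ / ⟪v, n⟫) • n

theorem inner_tangentNormal {n m c v : E3} (h : ⟪n, v⟫ ≠ 0) : ⟪tangentNormal n m c v, v⟫ = 0 := by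
  rw [tangentNormal, inner_sub_left, real_inner_smul_left, real_inner_comm v (c - m),
    real_inner_comm n v]
  rw [div_mul_cancel₀ _ h, sub_self]

namespace LineField

variable {K : Set E3} {U : E3 → E3} {a n m : E3} {ρ : ℝ}

theorem crossing_of_not_tangent (D : DiscSection K a n m ρ) {c n' : E3}
    (hc : c ∈ frontier K) (hcp : c ∈ planeAt a n) (hU : ⟪n, U c⟫ ≠ 0)
    (hN : ¬ CosphericalSection K c (tangentNormal n m c (U c))) (hn' : Admissible K U c n') :
    Crossing K c n' a n := by
  obtain ⟨h1, h2, h3⟩ := hn'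
  have hn1 := D.norm_eq
  have hn'0 : n' ≠ 0 := by rintro rfl; simp at h1
  have hw := (D.frontier_iff c hcp).1 hc
  have hnw := D.inner_sub_center hcp
  set w := c - m with hwdef
  have hi : Indep n n' := by
    refine indep_of_eq_zero D.ne_zero fun k hk => ?_
    rw [hk, real_inner_smul_left] at h2
    have := (mul_eq_zero.1 h2).resolve_right hU
    rw [this, zero_smul] at hk
    exact hn'0 hk
  set p := n' - ⟪n', n⟫ • n with hp
  have hnp : ⟪n, p⟫ = 0 := by
    rw [hp, inner_sub_right, real_inner_smul_right, real_inner_self_eq_norm_sq, hn1,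
      real_inner_comm]; ring
  have hip : Indep w p := by
    refine indep_of_eq_zero ?_ fun k hk => hN ?_
    · intro h0
      rw [h0, norm_zero] at hw
      have := D.pos
      linarith
    · have e : n' = ⟪n', n⟫ • n + k • w := by rw [← hk, hp]; abel
      have e2 : ⟪n', n⟫ * ⟪n, U c⟫ + k * ⟪w, U c⟫ = 0 := by
        rw [← real_inner_smul_left, ← real_inner_smul_left, ← inner_add_left, ← e, h2]
      have e3 : ⟪n', n⟫ = - (k * (⟪U c, w⟫ / ⟪U c, n⟫)) := by
        rw [real_inner_comm w, real_inner_comm n (U c)]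
        field_simp
        linarith
      have e4 : n' = k • tangentNormal n m c (U c) := by
        rw [tangentNormal, ← hwdef, smul_sub, smul_smul]
        nth_rewrite 1 [e]
        rw [e3]
        module
      have hk0 : k ≠ 0 := by
        rintro rfl
        rw [zero_smul] at e4
        exact hn'0 e4
      have h5 := h3
      unfold CosphericalSection at h5 ⊢
      rwa [e4, planeAt_smul _ _ hk0] at h5
  have hp0 : ‖p‖ ^ 2 ≠ 0 := by simpa using hip.ne_right
  set d := w - (⟪w, p⟫ / ‖p‖ ^ 2) • p with hd
  have hpd : ⟪p, d⟫ = 0 := by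
    rw [hd, inner_sub_right, real_inner_smul_right, real_inner_self_eq_norm_sq,
      div_mul_cancel₀ _ hp0, real_inner_comm, sub_self]
  have hnd : ⟪n, d⟫ = 0 := by
    rw [hd, inner_sub_right, real_inner_smul_right, hnw, hnp]; ring
  have hn'd : ⟪n', d⟫ = 0 := by
    have : n' = p + ⟪n', n⟫ • n := by rw [hp]; abel
    rw [this, inner_add_left, real_inner_smul_left, hpd, hnd]; ring
  have hx : c + (-1 : ℝ) • d ∈ planeAt a n := add_smul_mem_planeAt hcp hnd _
  refine ⟨hi.symm, c + (-1 : ℝ) • d, (D.interior_iff _ hx).2 ?_,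
    add_smul_mem_planeAt (self_mem_planeAt c n') hn'd _, hx⟩
  have e5 : c + (-1 : ℝ) • d - m = (⟪w, p⟫ / ‖p‖ ^ 2) • p := by rw [hd, hwdef]; module
  rw [e5, norm_smul, mul_pow, Real.norm_eq_abs, sq_abs, ← hw]
  have hlt := hip
  unfold Indep at hlt
  have hpp : 0 < ‖p‖ ^ 2 := lt_of_le_of_ne (sq_nonneg _) hp0.symm
  rw [div_pow, div_mul_eq_mul_div, div_lt_iff₀ (by positivity)]
  nlinarith

theorem crossing_tangent (F : LineField K U) (D : DiscSection K a n m ρ) {c d x : E3}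
    (hc : c ∈ frontier K) (hcp : c ∈ planeAt a n) (hd : d ∈ frontier K) (hdp : d ∈ planeAt a n)
    (hx : x ∈ interior K) (hcd : c ≠ d) (hcx : 0 < ⟪tangentNormal n m c (U c), x - c⟫)
    (hdx : 0 < ⟪tangentNormal n m d (U d), x - d⟫) :
    Crossing K c (tangentNormal n m c (U c)) d (tangentNormal n m d (U d)) := by
  have hin : ∀ c d, c ∈ frontier K → c ∈ planeAt a n → d ∈ frontier K → d ∈ planeAt a n → c ≠ d →
      ⟪tangentNormal n m c (U c), d - c⟫ < 0 := by
    intro c d hc hcp hd hdp hcd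
    rw [tangentNormal, inner_sub_left, real_inner_smul_left, inner_sub_eq_zero_of_mem hdp hcp,
      mul_zero, sub_zero]
    have h1 := (D.frontier_iff c hcp).1 hc
    have h2 := (D.frontier_iff d hdp).1 hd
    have h3 := norm_add_sq_real (c - m) (d - c)
    rw [show c - m + (d - c) = d - m by abel, h1, h2] at h3
    have : 0 < ‖d - c‖ ^ 2 := by
      have := sub_ne_zero.2 hcd.symm
      positivity
    linarith
  have h1 := hin c d hc hcp hd hdp hcd
  have h2 := hin d c hd hdp hc hcp hcd.symm
  have hcK := ((mem_frontier_iff' F.compact).1 hc).1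
  have hdK := ((mem_frontier_iff' F.compact).1 hd).1
  set N := tangentNormal n m c (U c)
  set M := tangentNormal n m d (U d)
  have hN0 : N ≠ 0 := by intro h; rw [h, inner_zero_left] at h1; exact lt_irrefl _ h1
  have hNxd : 0 < ⟪N, x - d⟫ := by
    rw [show x - d = (x - c) - (d - c) by abel, inner_sub_right]; linarith
  refine ⟨indep_of_eq_zero hN0 fun k hk => ?_, ?_⟩
  · rw [hk, real_inner_smul_left, ← neg_sub, inner_neg_right] at h2
    rw [hk, real_inner_smul_left] at hdx
    have hk : 0 < k := by
      by_contra h; nlinarith [not_lt.1 h]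
    nlinarith
  · have hMx : ⟪M, x - c⟫ = ⟪M, x - d⟫ - ⟪M, c - d⟫ := by
      rw [← inner_sub_right]; congr 1; abel
    set t := -⟪M, c - d⟫ / ⟪M, x - c⟫ with ht
    have hden : 0 < ⟪M, x - c⟫ := by rw [hMx]; linarith
    have ht0 : 0 < t := div_pos (by linarith) hden
    have ht1 : t < 1 := by rw [ht, div_lt_one hden]; linarith
    have hy1 : x + (1 - t) • (c - x) ∈ interior K :=
      between_mem_interior F.convex hx hcK (by linarith) (by linarith)
    set y := x + (1 - t) • (c - x) with hy
    have hyc : y - c = t • (x - c) := by rw [hy]; module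
    have hMy : ⟪M, y - d⟫ = 0 := by
      rw [show y - d = (y - c) + (c - d) by abel, inner_add_right, hyc, real_inner_smul_right, ht,
        div_mul_cancel₀ _ hden.ne']
      ring
    have hNy : 0 < ⟪N, y - c⟫ := by
      rw [hyc, real_inner_smul_right]; positivity
    have hNyd : ⟪N, d - y⟫ = ⟪N, d - c⟫ - ⟪N, y - c⟫ := by
      rw [← inner_sub_right]; congr 1; abel
    set r := -⟪N, y - c⟫ / ⟪N, d - y⟫ with hr
    have hneg : ⟪N, d - y⟫ < 0 := by linarith
    have hr0 : 0 ≤ r := div_nonneg_of_nonpos (by linarith) hneg.le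
    have hr1 : r < 1 := by rw [hr, div_lt_one_of_neg hneg]; linarith
    refine ⟨y + r • (d - y), between_mem_interior F.convex hy1 hdK hr0 hr1, ?_, ?_⟩
    · rw [mem_planeAt, show y + r • (d - y) - c = (y - c) + r • (d - y) by abel, inner_add_right,
        real_inner_smul_right, hr, div_mul_cancel₀ _ hneg.ne]
      ring
    · rw [mem_planeAt, show y + r • (d - y) - d = (1 - r) • (y - d) by module,
        real_inner_smul_right, hMy, mul_zero]

/-- At a point where the line leaves the plane of a circular section, either all tangent planes
cut circular sections, and the boundary is spherical near the point, or some point of the circle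
has all its admissible planes crossing the given one. -/
theorem locallySpherical_or_crossing_of_transversal (F : LineField K U) (D : DiscSection K a n m ρ)
    {c₀ : E3} (hc : c₀ ∈ frontier K) (hcp : c₀ ∈ planeAt a n) (hU : ⟪n, U c₀⟫ ≠ 0) {V : Set E3}
    (hV : V ∈ 𝓝 c₀) :
    LocallySpherical K U ∨ ∃ c ∈ V, c ∈ frontier K ∧ ∀ᶠ y in 𝓝 c, y ∈ frontier K →
      ∀ n', Admissible K U y n' → Crossing K y n' a n := by
  by_cases h : ∃ c ∈ V, c ∈ frontier K ∧ c ∈ planeAt a n ∧ ⟪n, U c⟫ ≠ 0 ∧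
      ¬ CosphericalSection K c (tangentNormal n m c (U c))
  · obtain ⟨c, hcV, hcf, hcp, hcU, hcN⟩ := h
    right
    refine ⟨c, hcV, hcf, F.eventually_forall_admissible
      (Q := fun y n' => Crossing K y n' a n) fun n' _ hn' => ?_⟩
    filter_upwards [(crossing_of_not_tangent D hcf hcp hcU hcN hn').eventually_left] with p hp _ _
    exact hp
  push Not at h
  left
  set N : E3 → E3 := fun c => tangentNormal n m c (U c) with hNdef
  have hNU : ⟪N c₀, U c₀⟫ = 0 := inner_tangentNormal hU
  have hbot := D.neBot hc hcp
  set G := 𝓝[(frontier K ∩ planeAt a n) \ {c₀}] c₀ with hG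
  have hGle : G ≤ 𝓝[frontier K] c₀ := nhdsWithin_mono _ fun x hx => hx.1.1
  have hGmem : ∀ᶠ c in G, c ∈ frontier K ∧ c ∈ planeAt a n ∧ c ≠ c₀ := by
    filter_upwards [self_mem_nhdsWithin] with c hc using ⟨hc.1.1, hc.1.2, hc.2⟩
  have hGU : Tendsto U G (𝓝 (U c₀)) := (F.cont c₀ hc).tendsto.mono_left hGle
  have hGid : Tendsto id G (𝓝 c₀) := tendsto_id.mono_left nhdsWithin_le_nhds
  have hU' : ⟪U c₀, n⟫ ≠ 0 := by rwa [real_inner_comm]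
  have hGN : Tendsto N G (𝓝 (N c₀)) := by
    have h1 : Tendsto (fun c => c - m) G (𝓝 (c₀ - m)) := hGid.sub tendsto_const_nhds
    exact h1.sub ((((hGU.inner h1).div (hGU.inner tendsto_const_nhds) hU')).smul_const n)
  have hN0 : N c₀ ≠ 0 := by
    intro h0
    have h1 : ⟪N c₀, c₀ - m⟫ = ρ := by
      simp only [hNdef]
      rw [tangentNormal, inner_sub_left, real_inner_smul_left, D.inner_sub_center hcp,
        real_inner_self_eq_norm_sq, (D.frontier_iff _ hcp).1 hc]
      ring
    rw [h0, inner_zero_left] at h1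
    exact D.pos.ne h1
  obtain ⟨b, hb, hbp⟩ := F.exists_interior_mem_planeAt hc hNU
  obtain ⟨x, hx, hxN⟩ : ∃ x ∈ interior K, 0 < ⟪N c₀, x - c₀⟫ := by
    have hcont : Continuous fun t : ℝ => b + t • N c₀ := by fun_prop
    have hev : ∀ᶠ t in 𝓝 (0 : ℝ), b + t • N c₀ ∈ interior K :=
      hcont.continuousAt.eventually (isOpen_interior.mem_nhds (by simpa using hb))
    obtain ⟨t, ht, ht0⟩ := ((hev.filter_mono nhdsWithin_le_nhds).and
      (self_mem_nhdsWithin : Set.Ioi (0 : ℝ) ∈ 𝓝[>] 0)).exists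
    refine ⟨_, ht, ?_⟩
    rw [mem_planeAt] at hbp
    rw [show b + t • N c₀ - c₀ = (b - c₀) + t • N c₀ by abel, inner_add_right, hbp,
      real_inner_smul_right, real_inner_self_eq_norm_sq, zero_add]
    exact mul_pos ht0 (by positivity)
  let Good : E3 → Prop := fun c => c ∈ frontier K ∧ c ∈ planeAt a n ∧
    CosphericalSection K c (N c) ∧ 0 < ⟪N c, x - c⟫
  have hgood0 : Good c₀ := ⟨hc, hcp, h c₀ (mem_of_mem_nhds hV) hc hcp hU, hxN⟩
  have hGgood : ∀ᶠ c in G, Good c := by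
    have e1 : ∀ᶠ c in G, 0 < ⟪N c, x - c⟫ :=
      (hGN.inner (tendsto_const_nhds.sub hGid)).eventually (lt_mem_nhds hxN)
    have e2 : ∀ᶠ c in G, ⟪n, U c⟫ ≠ 0 :=
      (tendsto_const_nhds.inner hGU).eventually_ne hU
    filter_upwards [e1, e2, hGmem, nhdsWithin_le_nhds hV] with c h1 h2 h3 h4
    exact ⟨h3.1, h3.2.1, h c h4 h3.1 h3.2.1 h2, h1⟩
  have hcross : ∀ c d, Good c → Good d → c ≠ d → Crossing K c (N c) d (N d) :=
    fun c d hgc hgd hcd => F.crossing_tangent D hgc.1 hgc.2.1 hgd.1 hgd.2.1 hx hcd hgc.2.2.2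
      hgd.2.2.2
  have htwo : ∀ P : E3 → Prop, (∀ᶠ c in G, P c) → ∃ c d, P c ∧ P d ∧ c ≠ d ∧ c ≠ c₀ ∧ d ≠ c₀ := by
    intro P hP
    obtain ⟨c, h1, h2⟩ := (hP.and hGmem).exists
    have h3 : ∀ᶠ d in G, d ≠ c := hGid.eventually_ne h2.2.2.symm
    obtain ⟨d, h4, h5, h6⟩ := (hP.and (hGmem.and h3)).exists
    exact ⟨c, d, h1, h4, h6.symm, h2.2.2, h5.2.2⟩
  obtain ⟨M, R, hMR⟩ : ∃ M R, ∀ c, Good c → OnSphere (frontier K ∩ planeAt c (N c)) M R := by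
    obtain ⟨c, d, hgc, hgd, hcd, -, -⟩ := htwo Good hGgood
    obtain ⟨-, -, ⟨m1, -, ρ1, hs1⟩, -⟩ := id hgc
    obtain ⟨-, -, ⟨m2, -, ρ2, hs2⟩, -⟩ := id hgd
    obtain ⟨M, R, h1, h2⟩ := exists_common_sphere F.compact F.convex (hcross c d hgc hgd hcd)
      hs1 hs2
    refine ⟨M, R, fun z hgz => ?_⟩
    by_cases hzc : z = c
    · rwa [hzc]
    by_cases hzd : z = d
    · rwa [hzd]
    obtain ⟨-, -, ⟨m3, -, ρ3, hs3⟩, -⟩ := id hgz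
    exact onSphere_of_crossing F.compact F.convex h1 h2 hs3 (hcross z c hgz hgc hzc)
      (hcross z d hgz hgd hzd) (hcross c d hgc hgd hcd).planeAt_ne
  refine ⟨M, R, c₀, hc, F.eventually_forall_admissible
    (Q := fun y n' => OnSphere (frontier K ∩ planeAt y n') M R) fun n' _ hn' => ?_⟩
  have hn'0 : n' ≠ 0 := by rintro rfl; simpa using hn'.1
  have hev : ∀ᶠ d in G, Crossing K c₀ n' d (N d) := by
    by_cases hi : Indep (N c₀) n'
    · have h0 : Crossing K c₀ n' c₀ (N c₀) := by
        obtain ⟨s, -, hs⟩ := F.inward c₀ hc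
        rw [sub_eq_add_neg, ← neg_smul] at hs
        exact ⟨hi.symm, _, hs, add_smul_mem_planeAt (self_mem_planeAt _ _) hn'.2.1 _,
          add_smul_mem_planeAt (self_mem_planeAt _ _) hNU _⟩
      have := h0.symm.eventually_left
      filter_upwards [(hGid.prodMk_nhds hGN).eventually this] with d hd using hd.symm
    · obtain ⟨k, hk⟩ := exists_smul_of_not_indep hN0 hi
      have hk0 : k ≠ 0 := by rintro rfl; exact hn'0 (by simpa using hk)
      filter_upwards [hGgood, hGmem] with d hd hd'
      obtain ⟨h1, z, h2, h3, h4⟩ := hcross c₀ d hgood0 hd hd'.2.2.symm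
      refine ⟨hk ▸ h1.smul_left hk0, z, h2, ?_, h4⟩
      rwa [hk, planeAt_smul _ _ hk0]
  obtain ⟨c, d, ⟨h1, h2⟩, ⟨h3, h4⟩, h5, -, -⟩ := htwo _ (hev.and hGgood)
  filter_upwards [h1.eventually_left, h3.eventually_left] with p hp1 hp2 _ hpa
  obtain ⟨-, -, m3, -, ρ3, hs3⟩ := hpa
  exact onSphere_of_crossing F.compact F.convex (hMR c h2) (hMR d h4) hs3 hp1 hp2
    (hcross c d h2 h4 h5).planeAt_ne

end LineField

/-- The area form of the plane with orthogonal frame `w`, `e`, extended to `E3`. -/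
noncomputable def frameArea (w e p q : E3) : ℝ := ⟪w, p⟫ * ⟪e, q⟫ - ⟪e, p⟫ * ⟪w, q⟫

section frameArea

variable {n w e : E3} {ρ : ℝ}

theorem frameArea_sub_left (p p' q : E3) :
    frameArea w e (p - p') q = frameArea w e p q - frameArea w e p' q := by
  simp only [frameArea, inner_sub_right]; ring

theorem frameArea_add_left (p p' q : E3) :
    frameArea w e (p + p') q = frameArea w e p q + frameArea w e p' q := by
  simp only [frameArea, inner_add_right]; ring

theorem frameArea_smul_left (k : ℝ) (p q : E3) :
    frameArea w e (k • p) q = k * frameArea w e p q := by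
  simp only [frameArea, real_inner_smul_right]; ring

theorem frameArea_swap (p q : E3) : frameArea w e p q = -frameArea w e q p := by
  simp only [frameArea]; ring

theorem frameArea_self (p : E3) : frameArea w e p p = 0 := by
  simp only [frameArea]; ring

theorem exists_smul_of_frameArea_eq_zero (hn : n ≠ 0) (hw : ⟪n, w⟫ = 0) (he : ⟪n, e⟫ = 0)
    (hwe : ⟪w, e⟫ = 0) (hwρ : ‖w‖ ^ 2 = ρ) (heρ : ‖e‖ ^ 2 = ρ) (hρ : 0 < ρ) {p q : E3}
    (hp : ⟪n, p⟫ = 0) (hq : ⟪n, q⟫ = 0) (hq0 : q ≠ 0) (h : frameArea w e p q = 0) :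
    ∃ k : ℝ, p = k • q := by
  refine exists_smul_of_not_indep hq0 ?_
  have hi : Indep w e := by
    unfold Indep; rw [hwe, hwρ, heρ]; nlinarith
  obtain ⟨a, b, rfl⟩ := exists_combination hn hw he hp hi
  obtain ⟨c, d, rfl⟩ := exists_combination hn hw he hq hi
  have hww : ⟪w, w⟫ = ρ := by rw [real_inner_self_eq_norm_sq, hwρ]
  have hee : ⟪e, e⟫ = ρ := by rw [real_inner_self_eq_norm_sq, heρ]
  have hew : ⟪e, w⟫ = 0 := by rw [real_inner_comm, hwe]
  simp only [frameArea, inner_add_right, real_inner_smul_right, hww, hee, hwe, hew] at h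
  have h' : a * d - b * c = 0 := by
    have : ρ ^ 2 * (a * d - b * c) = 0 := by linarith
    exact (mul_eq_zero.1 this).resolve_left (by positivity)
  unfold Indep
  rw [← real_inner_self_eq_norm_sq, ← real_inner_self_eq_norm_sq]
  simp only [inner_add_right, inner_add_left, real_inner_smul_right, real_inner_smul_left, hww, hee,
    hwe, hew]
  rw [not_lt]
  apply le_of_eq
  linear_combination ρ ^ 2 * (a * d - b * c) * h'

end frameArea

theorem exists_zero_of_mul_nonpos {f : ℝ → ℝ} {x y : ℝ} (hf : ContinuousOn f (Set.uIcc x y))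
    (h : f x * f y ≤ 0) : ∃ t ∈ Set.uIcc x y, f t = 0 := by
  refine intermediate_value_uIcc hf ?_
  rw [Set.mem_uIcc]
  rcases mul_nonpos_iff.1 h with h | h
  · exact Or.inr ⟨h.2, h.1⟩
  · exact Or.inl h

theorem eq_or_eq_neg_of_smul {u v : E3} (hu : ‖u‖ = 1) (hv : ‖v‖ = 1) {k : ℝ} (h : u = k • v) :
    u = v ∨ u = -v := by
  rw [h, norm_smul, hv, mul_one, Real.norm_eq_abs] at hu
  rcases abs_eq zero_le_one |>.1 hu with rfl | rfl
  · left; simpa using h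
  · right; simpa using h

namespace LineField

variable {K : Set E3} {U : E3 → E3} {a n m : E3} {ρ : ℝ}

/-- Two lines in the plane of a circular section: position of the common point and orientation. -/
theorem frameArea_mul_neg (F : LineField K U) (D : DiscSection K a n m ρ) {c e : E3}
    (ha : a ∈ frontier K) (hUa : ⟪n, U a⟫ = 0) (hc : c ∈ frontier K) (hcp : c ∈ planeAt a n)
    (hUc : ⟪n, U c⟫ = 0) (he : ⟪n, e⟫ = 0) (hwe : ⟪a - m, e⟫ = 0) (heρ : ‖e‖ ^ 2 = ρ)
    (h : frameArea (a - m) e (c - a) (U a) ≠ 0) :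
    frameArea (a - m) e (U a) (U c) * frameArea (a - m) e (c - a) (U a) < 0 ∧
      a - (frameArea (a - m) e (a - c) (U c) / frameArea (a - m) e (U a) (U c)) • U a ∈
        interior K := by
  have hap := self_mem_planeAt a n
  have hwρ := (D.frontier_iff a hap).1 ha
  have hw := D.inner_sub_center hap
  set w := a - m with hwdef
  have par : ∀ {p q : E3}, ⟪n, p⟫ = 0 → ⟪n, q⟫ = 0 → q ≠ 0 → frameArea w e p q = 0 →
      ∃ k : ℝ, p = k • q := fun hp hq hq0 h0 =>
    exists_smul_of_frameArea_eq_zero D.ne_zero hw he hwe hwρ heρ D.pos hp hq hq0 h0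
  have hUc0 : U c ≠ 0 := by intro h0; simpa [h0] using F.norm_eq c hc
  have hUa0 : U a ≠ 0 := by intro h0; simpa [h0] using F.norm_eq a ha
  have hnotline : ∀ k : ℝ, c ≠ a + k • U a := by
    rintro k hk
    rw [hk, add_sub_cancel_left, frameArea_smul_left, frameArea_self, mul_zero] at h
    exact h rfl
  have hκ : frameArea w e (U a) (U c) ≠ 0 := by
    intro h0
    rw [frameArea_swap, neg_eq_zero] at h0
    obtain ⟨k, hk⟩ := par hUc hUa hUa0 h0
    obtain ⟨j, hj⟩ := F.parallel a ha c hc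
      (eq_or_eq_neg_of_smul (F.norm_eq c hc) (F.norm_eq a ha) hk)
    exact hnotline j hj
  set κ := frameArea w e (U a) (U c)
  set s := frameArea w e (a - c) (U c) / κ with hs
  have h1 : frameArea w e (a - s • U a - c) (U c) = 0 := by
    rw [show a - s • U a - c = (a - c) - s • U a by abel, frameArea_sub_left, frameArea_smul_left,
      hs, div_mul_cancel₀ _ hκ, sub_self]
  have h2 : ⟪n, a - s • U a - c⟫ = 0 := by
    rw [show a - s • U a - c = (a - c) - s • U a by abel, inner_sub_right, real_inner_smul_right,
      hUa, inner_sub_eq_zero_of_mem hap hcp]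
    ring
  obtain ⟨k, hk⟩ := par h2 hUc hUc0 h1
  have h3 : a + (-s) • U a = c + k • U c := by rw [← hk]; module
  have h4 : a + (-s) • U a ∈ interior K := by
    rcases F.meet a ha c hc _ _ h3 with h | ⟨j, hj, -⟩
    · exact h
    · exact absurd hj (hnotline j)
  refine ⟨?_, by rwa [sub_eq_add_neg, ← neg_smul]⟩
  have hkneg : k < 0 := F.neg_of_mem_interior hc (h3 ▸ h4)
  have h5 : frameArea w e (c - a) (U a) = k * κ := by
    have h6 : c - a = (-s) • U a - k • U c := by
      linear_combination (norm := module) -h3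
    rw [h6, frameArea_sub_left, frameArea_smul_left, frameArea_smul_left, frameArea_self,
      frameArea_swap]
    ring
  rw [h5]
  have : 0 < κ * κ := mul_self_pos.2 hκ
  nlinarith

/-- If the lines at the circle points near `a` stay in the plane of the circle, then the lines at
all boundary points near `a` meet that plane inside the body. -/
theorem eventually_meets_of_coplanar (F : LineField K U) (D : DiscSection K a n m ρ)
    (ha : a ∈ frontier K) {V : Set E3} (hV : V ∈ 𝓝 a)
    (hpl : ∀ c ∈ V, c ∈ frontier K → c ∈ planeAt a n → ⟪n, U c⟫ = 0) :
    ∀ᶠ y in 𝓝 a, y ∈ frontier K → ∃ q ∈ interior K, q ∈ planeAt a n ∧ ∃ t : ℝ, q = y + t • U y := by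
  have hap := self_mem_planeAt a n
  have hwρ := (D.frontier_iff a hap).1 ha
  have hw := D.inner_sub_center hap
  have hUa := hpl a (mem_of_mem_nhds hV) ha hap
  obtain ⟨e, he, hwe, heρ⟩ := D.exists_tangent a
  let γ : ℝ → E3 := fun θ => m + (Real.cos θ • (a - m) + Real.sin θ • e)
  have hγ : Continuous γ := by simp only [γ]; fun_prop
  have hγmem : ∀ θ, γ θ ∈ frontier K ∩ planeAt a n := D.circle_point_mem ha hap he hwe heρ
  have hγ0 : γ 0 = a := by simp [γ]
  have hwu : 0 < ⟪a - m, U a⟫ := by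
    obtain ⟨s, hs, hs'⟩ := F.inward a ha
    have hp : a - s • U a ∈ planeAt a n := by
      rw [sub_eq_add_neg, ← neg_smul]; exact add_smul_mem_planeAt hap hUa _
    have := (D.interior_iff _ hp).1 hs'
    rw [sub_right_comm, norm_sub_sq_real, hwρ, real_inner_smul_right, norm_smul, F.norm_eq a ha,
      Real.norm_of_nonneg hs.le] at this
    have : 0 < s * ⟪a - m, U a⟫ := by nlinarith
    exact (mul_pos_iff_of_pos_left hs).1 this
  have hg : ∀ θ, frameArea (a - m) e (γ θ - a) (U a) = -2 * ρ * Real.sin (θ / 2) *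
      (Real.sin (θ / 2) * ⟪e, U a⟫ + Real.cos (θ / 2) * ⟪a - m, U a⟫) := by
    intro θ
    have h1 : Real.cos θ = 1 - 2 * Real.sin (θ / 2) ^ 2 := by
      have := Real.cos_two_mul (θ / 2)
      rw [mul_div_cancel₀ _ two_ne_zero] at this
      rw [this, Real.cos_sq']; ring
    have h2 : Real.sin θ = 2 * Real.sin (θ / 2) * Real.cos (θ / 2) := by
      have := Real.sin_two_mul (θ / 2)
      rwa [mul_div_cancel₀ _ two_ne_zero] at this
    have h3 : γ θ - a = (Real.cos θ - 1) • (a - m) + Real.sin θ • e := by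
      simp only [γ]; module
    rw [h3, frameArea_add_left, frameArea_smul_left, frameArea_smul_left, h1, h2]
    simp only [frameArea, real_inner_self_eq_norm_sq, hwρ, heρ, real_inner_comm (a - m) e, hwe]
    ring
  have hev : ∀ᶠ θ in 𝓝 (0 : ℝ), γ θ ∈ V ∧
      0 < Real.sin (θ / 2) * ⟪e, U a⟫ + Real.cos (θ / 2) * ⟪a - m, U a⟫ := by
    refine (hγ.continuousAt.eventually (by rwa [hγ0])).and ?_
    have hc : Continuous fun θ : ℝ =>
      Real.sin (θ / 2) * ⟪e, U a⟫ + Real.cos (θ / 2) * ⟪a - m, U a⟫ := by fun_prop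
    exact hc.continuousAt.eventually (lt_mem_nhds (by simpa using hwu))
  obtain ⟨δ, hδ, hball⟩ := Metric.eventually_nhds_iff.1 hev
  obtain ⟨r, hr0, hrδ, hrπ⟩ : ∃ r : ℝ, 0 < r ∧ r < δ ∧ r < Real.pi := by
    refine ⟨min δ Real.pi / 2, ?_, ?_, ?_⟩
    · have := lt_min hδ Real.pi_pos; linarith
    · have := min_le_left δ Real.pi; linarith
    · have := min_le_right δ Real.pi
      have := Real.pi_pos; linarith
  have hθ : ∀ θ ∈ Set.uIcc (-r) r, γ θ ∈ V ∧
      0 < Real.sin (θ / 2) * ⟪e, U a⟫ + Real.cos (θ / 2) * ⟪a - m, U a⟫ := by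
    intro θ hθ
    rw [Set.uIcc_of_le (by linarith)] at hθ
    apply hball
    rw [Real.dist_eq, sub_zero, abs_lt]
    constructor <;> linarith [hθ.1, hθ.2]
  have hθU : ∀ θ ∈ Set.uIcc (-r) r, ⟪n, U (γ θ)⟫ = 0 := fun θ h =>
    hpl _ (hθ θ h).1 (hγmem θ).1 (hγmem θ).2
  have hsin : 0 < Real.sin (r / 2) :=
    Real.sin_pos_of_pos_of_lt_pi (by linarith) (by linarith [Real.pi_pos])
  set ω := frameArea (a - m) e with hω
  have hrm : r ∈ Set.uIcc (-r) r := Set.right_mem_uIcc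
  have hlm : -r ∈ Set.uIcc (-r) r := Set.left_mem_uIcc
  have hgp : ω (γ r - a) (U a) < 0 := by
    rw [hg]
    have := mul_pos (mul_pos D.pos hsin) (hθ r hrm).2
    linarith
  have hgm : 0 < ω (γ (-r) - a) (U a) := by
    rw [hg]
    have := mul_pos (mul_pos D.pos hsin) (hθ _ hlm).2
    rw [neg_div, Real.sin_neg] at *
    linarith
  obtain ⟨hp1, hp2⟩ := F.frameArea_mul_neg D ha hUa (hγmem r).1 (hγmem r).2 (hθU r hrm) he hwe heρ
    hgp.ne
  obtain ⟨hm1, hm2⟩ := F.frameArea_mul_neg D ha hUa (hγmem (-r)).1 (hγmem (-r)).2 (hθU _ hlm) he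
    hwe heρ hgm.ne'
  rw [← hω] at hp1 hp2 hm1 hm2
  have hκp : 0 < ω (U a) (U (γ r)) := by
    by_contra h
    have := mul_nonneg_of_nonpos_of_nonpos (not_lt.1 h) hgp.le
    linarith
  have hκm : ω (U a) (U (γ (-r))) < 0 := by
    by_contra h
    have := mul_nonneg (not_lt.1 h) hgm.le
    linarith
  have hUlim : Tendsto U (𝓝[frontier K] a) (𝓝 (U a)) := F.cont a ha
  have hid : Tendsto (fun y : E3 => y) (𝓝[frontier K] a) (𝓝 a) :=
    tendsto_id.mono_left nhdsWithin_le_nhds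
  have hωc : ∀ q : E3, Continuous fun p => ω p q := by
    intro q; simp only [hω, frameArea]; fun_prop
  have hA : ∀ θ, Tendsto (fun y => ω (y - γ θ) (U (γ θ))) (𝓝[frontier K] a)
      (𝓝 (ω (a - γ θ) (U (γ θ)))) := fun θ =>
    ((hωc _).tendsto _).comp (hid.sub tendsto_const_nhds)
  have hB : ∀ θ, Tendsto (fun y => ω (U y) (U (γ θ))) (𝓝[frontier K] a)
      (𝓝 (ω (U a) (U (γ θ)))) := fun θ => ((hωc _).tendsto _).comp hUlim
  have hP : ∀ θ, ω (U a) (U (γ θ)) ≠ 0 →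
      a - (ω (a - γ θ) (U (γ θ)) / ω (U a) (U (γ θ))) • U a ∈ interior K →
      ∀ᶠ y in 𝓝[frontier K] a,
        y - (ω (y - γ θ) (U (γ θ)) / ω (U y) (U (γ θ))) • U y ∈ interior K := fun θ h0 hi =>
    (hid.sub (((hA θ).div (hB θ) h0).smul hUlim)).eventually (isOpen_interior.mem_nhds hi)
  rw [← eventually_nhdsWithin_iff]
  filter_upwards [self_mem_nhdsWithin, hP r hκp.ne' hp2, hP (-r) hκm.ne hm2,
    (hB r).eventually (lt_mem_nhds hκp), (hB (-r)).eventually (gt_mem_nhds hκm)]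
    with y hy hPp hPm hBp hBm
  have hUy := F.norm_eq y hy
  have hUy0 : U y ≠ 0 := by intro h0; simp [h0] at hUy
  set lam := ⟪n, U y⟫ with hlam
  set μ := ⟪n, y - a⟫ with hμ
  have hqplane : lam ≠ 0 → y + (-(μ / lam)) • U y ∈ planeAt a n := by
    intro h0
    rw [mem_planeAt, show y + (-(μ / lam)) • U y - a = (y - a) + (-(μ / lam)) • U y by abel,
      inner_add_right, real_inner_smul_right, ← hlam, ← hμ, neg_mul, div_mul_cancel₀ _ h0]
    ring
  by_cases hzero : lam = 0 ∧ μ = 0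
  · obtain ⟨s, -, hs⟩ := F.inward y hy
    rw [sub_eq_add_neg, ← neg_smul] at hs
    exact ⟨_, hs, add_smul_mem_planeAt (mem_planeAt.2 hzero.2) hzero.1 _, _, rfl⟩
  let φ : ℝ → ℝ := fun θ => lam * ω (y - γ θ) (U (γ θ)) - μ * ω (U y) (U (γ θ))
  by_cases hφ : φ (-r) * φ r ≤ 0
  · have hUγ : Continuous fun θ => U (γ θ) := by
      rw [← continuousOn_univ]
      exact F.cont.comp hγ.continuousOn fun θ _ => (hγmem θ).1
    have hφc : Continuous φ := by
      simp only [φ, hω, frameArea]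
      generalize hgU : (fun θ => U (γ θ)) = g at hUγ
      simp only [show ∀ θ, U (γ θ) = g θ from fun θ => congrFun hgU θ]
      fun_prop
    obtain ⟨θ, hθm, hθ0⟩ := exists_zero_of_mul_nonpos hφc.continuousOn hφ
    have hc := (hγmem θ).1
    have hcp := (hγmem θ).2
    have hUc := hθU θ hθm
    set c := γ θ with hcdef
    have hUc0 : U c ≠ 0 := by intro h0; simpa [h0] using F.norm_eq c hc
    simp only [φ, ← hcdef] at hθ0
    by_cases hl : lam = 0
    · exfalso
      have hμ0 : μ ≠ 0 := fun h => hzero ⟨hl, h⟩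
      rw [hl, zero_mul, zero_sub, neg_eq_zero] at hθ0
      obtain ⟨k, hk⟩ := exists_smul_of_frameArea_eq_zero D.ne_zero hw he hwe hwρ heρ D.pos hl hUc
        hUc0 ((mul_eq_zero.1 hθ0).resolve_left hμ0)
      have hpar : U c = U y ∨ U c = -U y := by
        rcases eq_or_eq_neg_of_smul hUy (F.norm_eq c hc) hk with h | h
        · exact Or.inl h.symm
        · right; rw [h, neg_neg]
      obtain ⟨j, hj⟩ := F.parallel y hy c hc hpar
      apply hμ0
      have := mem_planeAt.1 hcp
      rw [hj, show y + j • U y - a = (y - a) + j • U y by abel, inner_add_right,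
        real_inner_smul_right, ← hlam, hl, mul_zero, add_zero] at this
      exact this
    · have hq := hqplane hl
      have h1 : ω (y + (-(μ / lam)) • U y - c) (U c) = 0 := by
        rw [show y + (-(μ / lam)) • U y - c = (y - c) + (-(μ / lam)) • U y by abel, hω,
          frameArea_add_left, frameArea_smul_left, ← hω]
        field_simp
        linarith
      obtain ⟨k, hk⟩ := exists_smul_of_frameArea_eq_zero D.ne_zero hw he hwe hwρ heρ D.pos
        (inner_sub_eq_zero_of_mem hq hcp) hUc hUc0 h1
      have h2 : y + (-(μ / lam)) • U y = c + k • U c := by rw [← hk]; abel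
      rcases F.meet y hy c hc _ _ h2 with h | ⟨j, -, h | h⟩
      · exact ⟨_, h, hq, _, rfl⟩
      · rw [h] at hUc; exact absurd hUc hl
      · rw [h, inner_neg_right, neg_eq_zero] at hUc; exact absurd hUc hl
  · rw [not_le] at hφ
    simp only [φ] at hφ
    set Ap := ω (y - γ r) (U (γ r))
    set Bp := ω (U y) (U (γ r))
    set Am := ω (y - γ (-r)) (U (γ (-r)))
    set Bm := ω (U y) (U (γ (-r)))
    have hBB : Bp * Bm < 0 := mul_neg_of_pos_of_neg hBp hBm
    have hl : lam ≠ 0 := by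
      intro hl
      rw [hl] at hφ
      have : 0 ≤ μ ^ 2 := sq_nonneg μ
      nlinarith
    have hrel : (Am / Bm - μ / lam) * (Ap / Bp - μ / lam) < 0 := by
      have h1 : (lam * Am - μ * Bm) * (lam * Ap - μ * Bp) =
          (lam ^ 2 * (Bp * Bm)) * ((Am / Bm - μ / lam) * (Ap / Bp - μ / lam)) := by
        have := hBm.ne
        have := hBp.ne'
        field_simp
      rw [h1] at hφ
      by_contra h
      have h3 : lam ^ 2 * (Bp * Bm) < 0 := mul_neg_of_pos_of_neg (by positivity) hBB
      have := mul_nonpos_of_nonpos_of_nonneg h3.le (not_lt.1 h)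
      linarith
    refine ⟨_, ?_, hqplane hl, _, rfl⟩
    set τ := μ / lam
    set x1 := Am / Bm
    set x2 := Ap / Bp
    have hne : x2 - x1 ≠ 0 := by
      intro h
      rw [sub_eq_zero] at h
      rw [h] at hrel
      nlinarith [mul_self_nonneg (x1 - τ)]
    have hconv := F.convex.interior hPm hPp (a := (x2 - τ) / (x2 - x1)) (b := (τ - x1) / (x2 - x1))
      (by
        rw [div_nonneg_iff]
        rcases mul_neg_iff.1 hrel with h | h
        · right; constructor <;> linarith
        · left; constructor <;> linarith)
      (by
        rw [div_nonneg_iff]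
        rcases mul_neg_iff.1 hrel with h | h
        · right; constructor <;> linarith
        · left; constructor <;> linarith)
      (by field_simp; ring)
    convert hconv using 1
    match_scalars
    · field_simp; ring
    · field_simp; ring

/-- Near a suitable boundary point, every admissible plane crosses a given admissible plane inside
the body or coincides with it, unless the boundary is already locally spherical. -/
theorem locallySpherical_or_crossing (F : LineField K U) {a n : E3} (ha : a ∈ frontier K)
    (hn : Admissible K U a n) {V : Set E3} (hV : V ∈ 𝓝 a) :
    LocallySpherical K U ∨ ∃ c ∈ V, c ∈ frontier K ∧ ∀ᶠ y in 𝓝 c, y ∈ frontier K →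
      ∀ n', Admissible K U y n' → Crossing K y n' a n ∨ planeAt y n' = planeAt a n := by
  obtain ⟨m, ρ, D⟩ := F.exists_discSection ha hn
  obtain ⟨V', hV'V, hV'o, haV'⟩ := mem_nhds_iff.1 hV
  by_cases hpl : ∀ c ∈ V', c ∈ frontier K → c ∈ planeAt a n → ⟪n, U c⟫ = 0
  · right
    refine ⟨a, mem_of_mem_nhds hV, ha, ?_⟩
    filter_upwards [F.eventually_meets_of_coplanar D ha (hV'o.mem_nhds haV') hpl]
      with y hy hyf n' hn'
    obtain ⟨q, hq, hqp, t, rfl⟩ := hy hyf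
    have hn0' : n' ≠ 0 := by rintro rfl; simpa using hn'.1
    exact crossing_or_planeAt_eq hn0' D.ne_zero hq
      (add_smul_mem_planeAt (self_mem_planeAt _ _) hn'.2.1 _) hqp
  · push Not at hpl
    obtain ⟨c, hc, hcf, hcp, hcU⟩ := hpl
    rcases F.locallySpherical_or_crossing_of_transversal D hcf hcp hcU
      (mem_of_superset (hV'o.mem_nhds hc) hV'V) with h | ⟨c', hc', hcf', h⟩
    · exact Or.inl h
    · refine Or.inr ⟨c', hc', hcf', ?_⟩
      filter_upwards [h] with y hy hyf n' hn'
      exact Or.inl (hy hyf n' hn')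

theorem locallySpherical (F : LineField K U) (hne : (frontier K).Nonempty)
    (hadm : ∀ y ∈ frontier K, ∃ n, Admissible K U y n) : LocallySpherical K U := by
  obtain ⟨y₀, hy₀⟩ := hne
  obtain ⟨n₀, hn₀⟩ := hadm y₀ hy₀
  rcases F.locallySpherical_or_crossing hy₀ hn₀ univ_mem with h | ⟨c, -, hc, hev⟩
  · exact h
  rw [eventually_iff, mem_nhds_iff] at hev
  obtain ⟨W, hW, hWo, hcW⟩ := hev
  have hn0 : n₀ ≠ 0 := by rintro rfl; simpa using hn₀.1
  obtain ⟨b, hb, hbp⟩ := F.exists_interior_mem_planeAt hy₀ hn₀.2.1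
  obtain ⟨y₁, hy₁W, hy₁, hy₁p⟩ :=
    exists_frontier_off_plane F.compact F.convex (hWo.mem_nhds hcW) hc hn0 hb hbp
  obtain ⟨n₁, hn₁⟩ := hadm y₁ hy₁
  have hne : planeAt y₁ n₁ ≠ planeAt y₀ n₀ := fun h => hy₁p (h ▸ self_mem_planeAt y₁ n₁)
  have hcr := (hW hy₁W hy₁ n₁ hn₁).resolve_right hne
  obtain ⟨-, -, m₀, -, ρ₀, h₀⟩ := hn₀
  obtain ⟨-, -, m₁, -, ρ₁, h₁⟩ := id hn₁
  obtain ⟨m, ρ, hS₁, hS₀⟩ := exists_common_sphere F.compact F.convex hcr h₁ h₀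
  rcases F.locallySpherical_or_crossing hy₁ hn₁ (hWo.mem_nhds hy₁W) with h | ⟨c₂, hc₂W, hc₂, hev₂⟩
  · exact h
  refine ⟨m, ρ, c₂, hc₂, ?_⟩
  filter_upwards [hev₂, hWo.mem_nhds hc₂W] with z hz hzW hzf n hn
  rcases hz hzf n hn with hz1 | hz1
  · rcases hW hzW hzf n hn with hz0 | hz0
    · obtain ⟨-, -, m₂, -, ρ₂, h₂⟩ := hn
      exact onSphere_of_crossing F.compact F.convex hS₁ hS₀ h₂ hz1 hz0 hne
    · rwa [hz0]
  · rwa [hz1]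

end LineField

/-- A set determined, among the sets lying on a sphere, by any of its local pieces. -/
def SphericallyRigid (A : Set E3) : Prop :=
  ∀ m ρ, ∀ x ∈ A, ∀ V ∈ 𝓝 x, OnSphere (V ∩ A) m ρ → OnSphere A m ρ

/-- Every line of the field is the intersection of two planes at an angle bounded from below, with
rigid sections, one of them cospherical. -/
def HasSections (K : Set E3) (U : E3 → E3) (β : ℝ) : Prop :=
  ∀ y ∈ frontier K, ∃ n₁ n₂ : E3, Admissible K U y n₁ ∧ ‖n₂‖ = 1 ∧ ⟪n₂, U y⟫ = 0 ∧
    |⟪n₁, n₂⟫| ≤ β ∧ SphericallyRigid (frontier K ∩ planeAt y n₂)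

/-- Near `y`, all admissible sections lie on the given sphere. -/
def SphericalNear (K : Set E3) (U : E3 → E3) (m : E3) (ρ : ℝ) (y : E3) : Prop :=
  ∀ᶠ z in 𝓝 y, z ∈ frontier K → ∀ n, Admissible K U z n → OnSphere (frontier K ∩ planeAt z n) m ρ

namespace LineField

variable {K : Set E3} {U : E3 → E3} {m : E3} {ρ β : ℝ}

theorem exists_normals (H : HasSections K U β) {y : E3} (hy : y ∈ frontier K)
    (hG : SphericalNear K U m ρ y) : ∃ n₁ n₂ : E3, ‖n₁‖ = 1 ∧ ‖n₂‖ = 1 ∧ ⟪n₁, U y⟫ = 0 ∧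
      ⟪n₂, U y⟫ = 0 ∧ |⟪n₁, n₂⟫| ≤ β ∧ OnSphere (frontier K ∩ planeAt y n₁) m ρ ∧
      OnSphere (frontier K ∩ planeAt y n₂) m ρ := by
  obtain ⟨n₁, n₂, h1, h2, h3, h4, h5⟩ := H y hy
  refine ⟨n₁, n₂, h1.1, h2, h1.2.1, h3, h4, hG.self_of_nhds hy n₁ h1, ?_⟩
  refine h5 m ρ y ⟨hy, self_mem_planeAt _ _⟩ _ hG ?_
  rintro x ⟨hx, hxf, -⟩
  obtain ⟨k, -, hk, -⟩ := H x hxf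
  exact hx hxf k hk x ⟨hxf, self_mem_planeAt _ _⟩

/-- A plane through `L_a` is not parallel to both limits of the section planes. -/
theorem exists_onSphere_crossing (F : LineField K U) (H : HasSections K U β) (hβ : β < 1) {a : E3}
    (ha : a ∈ closure {y | y ∈ frontier K ∧ SphericalNear K U m ρ y}) {n₀ : E3} (hn₀ : ‖n₀‖ = 1)
    (hn₀U : ⟪n₀, U a⟫ = 0) {p n b : E3} (hn : n ≠ 0) (hb : b ∈ interior K) (hbp : b ∈ planeAt p n) :
    ∃ y k, y ∉ planeAt p n ∧ OnSphere (frontier K ∩ planeAt y k) m ρ ∧ Crossing K a n₀ y k := by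
  have haf : a ∈ frontier K :=
    isClosed_frontier.closure_subset_iff.2 (fun y (hy : y ∈ frontier K ∧ _) => hy.1) ha
  have ha' : a ∈ closure {y | (y ∈ frontier K ∧ SphericalNear K U m ρ y) ∧ y ∉ planeAt p n} := by
    rw [mem_closure_iff_nhds] at ha ⊢
    intro V hV
    obtain ⟨V', hV'V, hV'o, haV'⟩ := mem_nhds_iff.1 hV
    obtain ⟨y, hyV, hy, hyG⟩ := ha V' (hV'o.mem_nhds haV')
    have hyG' : ∀ᶠ z in 𝓝 y, SphericalNear K U m ρ z := eventually_eventually_nhds.2 hyG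
    obtain ⟨z, ⟨hzV, hzG⟩, hz, hzp⟩ := exists_frontier_off_plane F.compact F.convex
      (inter_mem (hV'o.mem_nhds hyV) hyG') hy hn hb hbp
    exact ⟨z, hV'V hzV, ⟨hz, hzG⟩, hzp⟩
  rw [mem_closure_iff_ultrafilter] at ha'
  obtain ⟨G, hGm, hGa⟩ := ha'
  have hex : ∀ y, ∃ q : E3 × E3, q ∈ Metric.sphere (0 : E3) 1 ×ˢ Metric.sphere (0 : E3) 1 ∧
      ((y ∈ frontier K ∧ SphericalNear K U m ρ y) ∧ y ∉ planeAt p n → ⟪q.1, U y⟫ = 0 ∧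
        ⟪q.2, U y⟫ = 0 ∧ |⟪q.1, q.2⟫| ≤ β ∧ OnSphere (frontier K ∩ planeAt y q.1) m ρ ∧
        OnSphere (frontier K ∩ planeAt y q.2) m ρ) := by
    intro y
    by_cases hy : (y ∈ frontier K ∧ SphericalNear K U m ρ y) ∧ y ∉ planeAt p n
    · obtain ⟨k₁, k₂, h1, h2, h⟩ := exists_normals H hy.1.1 hy.1.2
      exact ⟨(k₁, k₂), ⟨by simpa using h1, by simpa using h2⟩, fun _ => h⟩
    · exact ⟨(n₀, n₀), ⟨by simpa using hn₀, by simpa using hn₀⟩, fun h => absurd h hy⟩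
  choose q hq hq' using hex
  obtain ⟨⟨g₁, g₂⟩, hg, hlim⟩ := ((isCompact_sphere (0 : E3) 1).prod
    (isCompact_sphere (0 : E3) 1)).ultrafilter_le_nhds (G.map q) (by
      rw [le_principal_iff]
      have : q ⁻¹' (Metric.sphere (0 : E3) 1 ×ˢ Metric.sphere (0 : E3) 1) ∈ (G : Filter E3) :=
        univ_mem' hq
      exact this)
  have hlim' : Tendsto q (G : Filter E3) (𝓝 (g₁, g₂)) := hlim
  have hl1 : Tendsto (fun y => (q y).1) (G : Filter E3) (𝓝 g₁) :=
    (continuous_fst.tendsto _).comp hlim'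
  have hl2 : Tendsto (fun y => (q y).2) (G : Filter E3) (𝓝 g₂) :=
    (continuous_snd.tendsto _).comp hlim'
  have hev : ∀ᶠ y in (G : Filter E3),
      (y ∈ frontier K ∧ SphericalNear K U m ρ y) ∧ y ∉ planeAt p n :=
    hGm
  have hGU : Tendsto U (G : Filter E3) (𝓝 (U a)) :=
    (F.cont a haf).tendsto.comp (tendsto_nhdsWithin_iff.2 ⟨hGa, hev.mono fun y hy => hy.1.1⟩)
  have hβ' : |⟪g₁, g₂⟫| ≤ β :=
    le_of_tendsto (hl1.inner hl2).abs (hev.mono fun y hy => (hq' y hy).2.2.1)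
  have h1U : ⟪g₁, U a⟫ = 0 := tendsto_nhds_unique
    ((hl1.inner hGU).congr' (hev.mono fun y hy => (hq' y hy).1)) tendsto_const_nhds
  have h2U : ⟪g₂, U a⟫ = 0 := tendsto_nhds_unique
    ((hl2.inner hGU).congr' (hev.mono fun y hy => (hq' y hy).2.1)) tendsto_const_nhds
  have hg1 : ‖g₁‖ = 1 := by simpa using hg.1
  have hg2 : ‖g₂‖ = 1 := by simpa using hg.2
  obtain ⟨s, -, hs⟩ := F.inward a haf
  rw [sub_eq_add_neg, ← neg_smul] at hs
  have hcross : ∀ g : E3, ⟪g, U a⟫ = 0 → Indep n₀ g → Crossing K a n₀ a g := fun g hgU hi =>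
    ⟨hi, _, hs, add_smul_mem_planeAt (self_mem_planeAt _ _) hn₀U _,
      add_smul_mem_planeAt (self_mem_planeAt _ _) hgU _⟩
  have hor : Indep n₀ g₁ ∨ Indep n₀ g₂ := by
    by_contra hno
    push Not at hno
    have hn₀0 : n₀ ≠ 0 := by rintro rfl; simp at hn₀
    obtain ⟨k₁, rfl⟩ := exists_smul_of_not_indep hn₀0 hno.1
    obtain ⟨k₂, rfl⟩ := exists_smul_of_not_indep hn₀0 hno.2
    rw [norm_smul, hn₀, mul_one, Real.norm_eq_abs] at hg1 hg2
    rw [real_inner_smul_left, real_inner_smul_right, real_inner_self_eq_norm_sq, hn₀, abs_mul,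
      abs_mul, hg1, hg2] at hβ'
    norm_num at hβ'
    linarith
  have main : ∀ (g : E3) (f : E3 → E3), Tendsto f (G : Filter E3) (𝓝 g) → Crossing K a n₀ a g →
      ∀ᶠ y in (G : Filter E3), Crossing K a n₀ y (f y) := by
    intro g f hf hc
    have : ∀ᶠ y in (G : Filter E3), Crossing K y (f y) a n₀ :=
      (Tendsto.prodMk_nhds hGa hf).eventually hc.symm.eventually_left
    exact this.mono fun y hy => hy.symm
  rcases hor with h | h
  · obtain ⟨y, hy, hc⟩ := (hev.and (main g₁ _ hl1 (hcross g₁ h1U h))).exists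
    exact ⟨y, _, hy.2, (hq' y hy).2.2.2.1, hc⟩
  · obtain ⟨y, hy, hc⟩ := (hev.and (main g₂ _ hl2 (hcross g₂ h2U h))).exists
    exact ⟨y, _, hy.2, (hq' y hy).2.2.2.2, hc⟩

theorem sphericalNear_of_mem_closure (F : LineField K U) (H : HasSections K U β) (hβ : β < 1)
    {a : E3} (ha : a ∈ closure {y | y ∈ frontier K ∧ SphericalNear K U m ρ y}) :
    SphericalNear K U m ρ a := by
  refine F.eventually_forall_admissible fun n haf hn => ?_
  obtain ⟨b, hb⟩ := F.exists_interior_mem_planeAt haf hn.2.1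
  have hn0 : n ≠ 0 := by rintro rfl; simpa using hn.1
  obtain ⟨y₁, k₁, -, hS₁, hc₁⟩ := F.exists_onSphere_crossing H hβ ha hn.1 hn.2.1 hn0 hb.1 hb.2
  obtain ⟨x, hx, -, hxp⟩ := hc₁.2
  obtain ⟨y₂, k₂, hy₂, hS₂, hc₂⟩ :=
    F.exists_onSphere_crossing H hβ ha hn.1 hn.2.1 hc₁.1.ne_right hx hxp
  have hne : planeAt y₁ k₁ ≠ planeAt y₂ k₂ := fun h => hy₂ (h ▸ self_mem_planeAt y₂ k₂)
  filter_upwards [hc₁.eventually_left, hc₂.eventually_left] with p hp1 hp2 hpf hpa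
  obtain ⟨-, -, m', -, ρ', h'⟩ := hpa
  exact onSphere_of_crossing F.compact F.convex hS₁ hS₂ h' hp1 hp2 hne

end LineField

theorem isPreconnected_frontier {K : Set E3} (hK : IsCompact K) (hc : Convex ℝ K)
    (hi : (interior K).Nonempty) : IsPreconnected (frontier K) := by
  obtain ⟨e, -, -, h3⟩ :=
    exists_homeomorph_image_interior_closure_frontier_eq_unitBall hc hi hK.isBounded
  have h := isPreconnected_sphere (E := E3) (by
    rw [← Module.finrank_eq_rank, finrank_euclideanSpace_fin]; norm_num) 0 1
  rw [← h3] at h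
  have := h.image e.symm e.symm.continuous.continuousOn
  rwa [← Set.image_comp, e.symm_comp_self, Set.image_id] at this

theorem LineField.onSphere_frontier {K : Set E3} {U : E3 → E3} {β : ℝ} (F : LineField K U)
    (hi : (interior K).Nonempty) (hne : (frontier K).Nonempty) (H : HasSections K U β)
    (hβ : β < 1) : ∃ m ρ, OnSphere (frontier K) m ρ := by
  have hadm : ∀ y ∈ frontier K, ∃ n, Admissible K U y n := fun y hy =>
    let ⟨n, _, h, _⟩ := H y hy; ⟨n, h⟩
  obtain ⟨m, ρ, c, hc, hS⟩ := F.locallySpherical hne hadm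
  refine ⟨m, ρ, ?_⟩
  have hGo : IsOpen {y | SphericalNear K U m ρ y} :=
    isOpen_iff_mem_nhds.2 fun y hy => eventually_eventually_nhds.2 hy
  have hcl : ∀ a ∈ closure {y | y ∈ frontier K ∧ SphericalNear K U m ρ y},
      SphericalNear K U m ρ a :=
    fun a ha => F.sphericalNear_of_mem_closure H hβ ha
  have hsub : ∀ y ∈ frontier K, SphericalNear K U m ρ y := by
    intro a ha
    by_contra hna
    obtain ⟨x, hx, hx1, hx2⟩ := isPreconnected_frontier F.compact F.convex hi _ _ hGo
      (isClosed_closure (s := {y | y ∈ frontier K ∧ SphericalNear K U m ρ y})).isOpen_compl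
      (fun y _ => (em (y ∈ closure _)).imp (hcl y) id) ⟨c, hc, hS⟩ ⟨a, ha, fun h => hna (hcl a h)⟩
    exact hx2 (subset_closure ⟨hx, hx1⟩)
  intro y hy
  obtain ⟨n, hn⟩ := hadm y hy
  exact (hsub y hy).self_of_nhds hy n hn y ⟨hy, self_mem_planeAt y n⟩

theorem isSphere_of_onSphere {K : Set E3} (hK : IsCompact K) (hc : Convex ℝ K)
    (hi : (interior K).Nonempty) {m : E3} {ρ : ℝ} (h : OnSphere (frontier K) m ρ) :
    IsSphere (frontier K) := by
  obtain ⟨b, hb⟩ := hi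
  have key : ∀ x, x ≠ b → ‖b - m‖ ^ 2 < ρ ∧ (x ∈ K ↔ ‖x - m‖ ^ 2 ≤ ρ) ∧
      (x ∈ interior K ↔ ‖x - m‖ ^ 2 < ρ) := fun x hx =>
    line_disc hK hc hb hx fun t ht => h _ ht
  obtain ⟨x₀, hx₀⟩ := exists_ne b
  have hbρ := (key x₀ hx₀).1
  have hρ : 0 < ρ := lt_of_le_of_lt (sq_nonneg _) hbρ
  refine ⟨m, √ρ, Real.sqrt_pos.2 hρ, Set.Subset.antisymm (fun x hx => ?_) fun x hx => ?_⟩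
  · rw [mem_sphere_iff_norm, ← h x hx, Real.sqrt_sq (norm_nonneg _)]
  · rw [mem_sphere_iff_norm] at hx
    have hx2 : ‖x - m‖ ^ 2 = ρ := by rw [hx, Real.sq_sqrt hρ.le]
    have hxb : x ≠ b := by rintro rfl; exact hbρ.ne hx2
    rw [mem_frontier_iff' hK]
    exact ⟨(key x hxb).2.1.2 hx2.le, fun hxi => ((key x hxb).2.2.1 hxi).ne hx2⟩

/-- An ellipse is determined, among the sets lying on a sphere, by any of its arcs. -/
theorem IsEllipse.sphericallyRigid {A : Set E3} (hA : IsEllipse A) : SphericallyRigid A := by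
  obtain ⟨f, rfl⟩ := hA
  intro m ρ x hx V hV h
  let p : ℝ → E3 := fun t => !₂[Real.cos t, Real.sin t, 0]
  have hpmem : ∀ t, p t ∈ unitCircle3 := fun t => ⟨by simp [p], by simp [p]⟩
  have hp : ∀ z ∈ unitCircle3, ∃ t, z = p t := by
    rintro z ⟨h1, h2⟩
    obtain ⟨t, ht1, ht2⟩ : ∃ t : ℝ, z 0 = Real.cos t ∧ z 1 = Real.sin t := by
      refine ⟨Complex.arg ⟨z 0, z 1⟩, ?_, ?_⟩
      all_goals
        have hn : ‖(⟨z 0, z 1⟩ : ℂ)‖ = 1 := by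
          rw [Complex.norm_def, Complex.normSq_mk, ← sq, ← sq, h1, Real.sqrt_one]
      · have := Complex.norm_mul_cos_arg ⟨z 0, z 1⟩
        rw [hn, one_mul] at this; exact this.symm
      · have := Complex.norm_mul_sin_arg ⟨z 0, z 1⟩
        rw [hn, one_mul] at this; exact this.symm
    refine ⟨t, ?_⟩
    ext i
    fin_cases i
    · simpa [p] using ht1
    · simpa [p] using ht2
    · simpa [p] using h2
  have hfp : ∀ t, f (p t) = f 0 + (Real.cos t • f.linear !₂[1, 0, 0] +
      Real.sin t • f.linear !₂[0, 1, 0]) := by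
    intro t
    have h1 := f.map_vadd 0 (p t)
    have h2 : p t = Real.cos t • !₂[1, 0, 0] + Real.sin t • !₂[0, 1, 0] := by
      ext i; fin_cases i <;> simp [p]
    rw [vadd_eq_add, add_zero, vadd_eq_add] at h1
    rw [h1, add_comm, h2, map_add, map_smul, map_smul]
  have hfc : ContDiff ℝ ⊤ fun t => f (p t) := by
    simp only [hfp]
    exact contDiff_const.add ((Real.contDiff_cos.smul contDiff_const).add
      (Real.contDiff_sin.smul contDiff_const))
  have hg : ContDiff ℝ ⊤ fun t => ‖f (p t) - m‖ ^ 2 - ρ :=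
    ((hfc.sub contDiff_const).norm_sq ℝ).sub contDiff_const
  obtain ⟨z, hz, rfl⟩ := hx
  obtain ⟨t₀, rfl⟩ := hp z hz
  have hev : (fun t => ‖f (p t) - m‖ ^ 2 - ρ) =ᶠ[𝓝 t₀] 0 := by
    filter_upwards [hfc.continuous.continuousAt.eventually hV] with t ht
    simpa [sub_eq_zero] using h _ ⟨ht, p t, hpmem t, rfl⟩
  have hz := (contDiff_omega_iff_analyticOnNhd.1 hg).eqOn_zero_of_preconnected_of_eventuallyEq_zero
    isPreconnected_univ (Set.mem_univ t₀) hev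
  rintro _ ⟨y, hy, rfl⟩
  obtain ⟨t, rfl⟩ := hp y hy
  exact sub_eq_zero.1 (hz (Set.mem_univ t))

theorem IsCircle.cosphericalSection {K : Set E3} (hK : IsCompact K) (hc : Convex ℝ K) {y n : E3}
    (h : IsCircle (frontier K ∩ planeAt y n)) : CosphericalSection K y n := by
  obtain ⟨H, c, r, ⟨n', -, k, rfl⟩, hcH, hr, h⟩ := h
  refine ⟨c, ?_, r ^ 2, fun x hx => ?_⟩
  · obtain ⟨d, hd, hd1, -⟩ := exists_orthogonal n' n'
    have hd0 : ‖d‖ ≠ 0 := by simpa using hd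
    have hmem : ∀ s : ℝ, |s| = 1 → c + (s * r / ‖d‖) • d ∈ K := by
      intro s hs
      have : c + (s * r / ‖d‖) • d ∈ frontier K ∩ planeAt y n := by
        rw [h]
        refine ⟨?_, ?_⟩
        · have hcH' : ⟪n', c⟫ = k := hcH
          change ⟪n', _⟫ = k
          rw [inner_add_right, real_inner_smul_right, hd1, mul_zero, add_zero, hcH']
        · rw [dist_eq_norm, add_sub_cancel_left, norm_smul, Real.norm_eq_abs, abs_div, abs_mul, hs,
            abs_norm, one_mul, div_mul_cancel₀ _ hd0, abs_of_pos hr]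
      exact hK.isClosed.frontier_subset this.1
    have := hc (hmem 1 (by simp)) (hmem (-1) (by simp)) (a := 1 / 2) (b := 1 / 2) (by norm_num)
      (by norm_num) (by norm_num)
    convert this using 1
    module
  · rw [h] at hx
    rw [← dist_eq_norm, hx.2]

theorem Complex.eq_of_exp_comp_const {f : ℝ → ℂ} (hf : Continuous f)
    (h : ∀ s t, Complex.exp (f s) = Complex.exp (f t)) (s t : ℝ) : f s = f t := by
  refine Complex.isCoveringMap_exp.const_of_comp hf (fun a a' => ?_) s t
  exact Subtype.ext (h a a')

theorem Complex.exists_continuous_log {F : ℝ × ℝ → ℂ} (hF : Continuous F) (h0 : ∀ p, F p ≠ 0) :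
    ∃ Λ : ℝ × ℝ → ℂ, Continuous Λ ∧ ∀ p, Complex.exp (Λ p) = F p := by
  let f : C(ℝ × ℝ, {z : ℂ // z ≠ 0}) := ⟨fun p => ⟨F p, h0 p⟩, by fun_prop⟩
  obtain ⟨Λ, ⟨-, hΛ⟩, -⟩ := Complex.isCoveringMap_exp.existsUnique_continuousMap_lifts f (0, 0)
    (Complex.log (F (0, 0))) (Subtype.ext (Complex.exp_log (h0 _)))
  exact ⟨Λ, Λ.continuous, fun p => congrArg Subtype.val (congrFun hΛ p)⟩

/-- Every continuous even tangent vector field on the 2-sphere has a zero. -/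
theorem exists_zero_of_even_tangent_field {v : E3 → E3}
    (hv : ContinuousOn v (Metric.sphere (0 : E3) 1)) (htan : ∀ u, ‖u‖ = 1 → ⟪v u, u⟫ = 0)
    (heven : ∀ u, ‖u‖ = 1 → v (-u) = v u) : ∃ u, ‖u‖ = 1 ∧ v u = 0 := by
  by_contra! hne
  let u : ℝ × ℝ → E3 := fun p =>
    !₂[Real.sin p.1 * Real.cos p.2, Real.sin p.1 * Real.sin p.2, Real.cos p.1]
  have hu : Continuous u := by
    simp only [u]; fun_prop
  have hu1 : ∀ p, ‖u p‖ = 1 := by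
    intro p
    have : ‖u p‖ ^ 2 = 1 := by
      rw [EuclideanSpace.norm_sq_eq, Fin.sum_univ_three]
      simp only [u, Real.norm_eq_abs, sq_abs]
      simp
      linear_combination (Real.sin p.1) ^ 2 * Real.sin_sq_add_cos_sq p.2 +
        Real.sin_sq_add_cos_sq p.1
    exact (pow_eq_one_iff_of_nonneg (norm_nonneg _) two_ne_zero).1 this
  let w : ℝ × ℝ → E3 := fun p => v (u p)
  have hw : Continuous w := by
    rw [← continuousOn_univ]
    exact hv.comp hu.continuousOn fun p _ => by simpa using hu1 p
  let A : ℝ × ℝ → ℝ := fun p => Real.cos p.1 * Real.cos p.2 * w p 0 +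
    Real.cos p.1 * Real.sin p.2 * w p 1 - Real.sin p.1 * w p 2
  let B : ℝ × ℝ → ℝ := fun p => Real.cos p.2 * w p 1 - Real.sin p.2 * w p 0
  let F : ℝ × ℝ → ℂ := fun p => A p + B p * Complex.I
  have hF : Continuous F := by
    simp only [F, A, B]; fun_prop
  have hF0 : ∀ p, F p ≠ 0 := by
    intro p hp
    have hA : A p = 0 := by simpa [F] using congrArg Complex.re hp
    have hB : B p = 0 := by simpa [F] using congrArg Complex.im hp
    have hC := htan (u p) (hu1 p)
    rw [E3.inner_def] at hC
    simp only [u] at hC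
    simp at hC
    simp only [A, B, w] at hA hB
    have e1 := Real.sin_sq_add_cos_sq p.1
    have e2 := Real.sin_sq_add_cos_sq p.2
    refine hne (u p) (hu1 p) ?_
    have ht : Real.cos p.2 * v (u p) 0 + Real.sin p.2 * v (u p) 1 = 0 := by
      linear_combination Real.sin p.1 * hC + Real.cos p.1 * hA -
        (Real.cos p.2 * v (u p) 0 + Real.sin p.2 * v (u p) 1) * e1
    ext i
    fin_cases i
    · change v (u p) 0 = 0
      linear_combination Real.cos p.2 * ht - Real.sin p.2 * hB - v (u p) 0 * e2
    · change v (u p) 1 = 0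
      linear_combination Real.sin p.2 * ht + Real.cos p.2 * hB - v (u p) 1 * e2
    · change v (u p) 2 = 0
      linear_combination Real.cos p.1 * hC - Real.sin p.1 * hA - v (u p) 2 * e1
  obtain ⟨Λ, hΛ, hexp⟩ := Complex.exists_continuous_log hF hF0
  have hk : Λ (0, 2 * Real.pi) - Λ (0, 0) =
      Λ (Real.pi / 2, 2 * Real.pi) - Λ (Real.pi / 2, 0) := by
    refine Complex.eq_of_exp_comp_const (f := fun r => Λ (r, 2 * Real.pi) - Λ (r, 0)) (by fun_prop)
      (fun s t => ?_) 0 (Real.pi / 2)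
    have hper : ∀ r, F (r, 2 * Real.pi) = F (r, 0) := by
      intro r
      have : u (r, 2 * Real.pi) = u (r, 0) := by simp [u]
      simp [F, A, B, w, this]
    simp only [Complex.exp_sub, hexp, hper]
    rw [div_self (hF0 _), div_self (hF0 _)]
  have h0 : Λ (0, 2 * Real.pi) + (2 * Real.pi : ℝ) * Complex.I = Λ (0, 0) := by
    have := Complex.eq_of_exp_comp_const (f := fun φ => Λ (0, φ) + (φ : ℝ) * Complex.I)
      (by fun_prop) (fun s t => ?_) (2 * Real.pi) 0
    · simpa using this
    · have hpole : ∀ φ : ℝ, F (0, φ) * Complex.exp (φ * Complex.I) =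
          v !₂[0, 0, 1] 0 + v !₂[0, 0, 1] 1 * Complex.I := by
        intro φ
        have hu0 : u (0, φ) = !₂[0, 0, 1] := by simp [u]
        rw [Complex.exp_mul_I, ← Complex.ofReal_cos, ← Complex.ofReal_sin]
        simp only [F, A, B, w, hu0]
        have e := Real.sin_sq_add_cos_sq φ
        generalize Real.cos φ = c at *
        generalize Real.sin φ = s at *
        apply Complex.ext
        · simp
          linear_combination v !₂[0, 0, 1] 0 * e
        · simp
          linear_combination v !₂[0, 0, 1] 1 * e
      simp only [Complex.exp_add, hexp, hpole]
  have h1 : Λ (Real.pi / 2, 2 * Real.pi) = Λ (Real.pi / 2, 0) := by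
    have hanti : ∀ s, F (Real.pi / 2, s + Real.pi) = (starRingEnd ℂ) (F (Real.pi / 2, s)) := by
      intro s
      have hu' : u (Real.pi / 2, s + Real.pi) = -u (Real.pi / 2, s) := by
        ext i; fin_cases i <;> simp [u]
      have hw' : w (Real.pi / 2, s + Real.pi) = w (Real.pi / 2, s) := by
        simp only [w, hu', heven _ (hu1 _)]
      have hA : A (Real.pi / 2, s + Real.pi) = A (Real.pi / 2, s) := by simp [A, hw']
      have hB : B (Real.pi / 2, s + Real.pi) = -B (Real.pi / 2, s) := by
        simp [B, hw']; ring
      simp [F, hA, hB]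
    have hone : ∀ s : ℝ, Complex.exp
        (Λ (Real.pi / 2, s + Real.pi) - (starRingEnd ℂ) (Λ (Real.pi / 2, s))) = 1 := fun s => by
      have hF' : (starRingEnd ℂ) (F (Real.pi / 2, s)) ≠ 0 := by simpa using hF0 _
      rw [Complex.exp_sub, Complex.exp_conj, hexp, hexp, hanti, div_self hF']
    have h2 := Complex.eq_of_exp_comp_const
      (f := fun s => Λ (Real.pi / 2, s + Real.pi) - (starRingEnd ℂ) (Λ (Real.pi / 2, s)))
      ((hΛ.comp (by fun_prop)).sub (Complex.continuous_conj.comp (hΛ.comp (by fun_prop))))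
      (fun s t => by rw [hone, hone]) Real.pi 0
    have h3 : (Λ (Real.pi / 2, Real.pi) - (starRingEnd ℂ) (Λ (Real.pi / 2, 0))).re = 0 := by
      have := congrArg norm (hone 0)
      rwa [Complex.norm_exp, norm_one, Real.exp_eq_one_iff, zero_add] at this
    simp only [zero_add, ← two_mul] at h2
    have h2r := congrArg Complex.re h2
    have h2i := congrArg Complex.im h2
    simp only [Complex.sub_re, Complex.sub_im, Complex.conj_re, Complex.conj_im] at h2r h2i h3
    apply Complex.ext <;> linarith
  rw [h1, sub_self, sub_eq_zero] at hk
  rw [hk, add_eq_left] at h0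
  simp [Real.pi_ne_zero] at h0

theorem lineThrough_eq {p q v : E3} (h : q ∈ lineThrough p v) :
    lineThrough p v = lineThrough q v := by
  obtain ⟨t, rfl⟩ := h
  ext x
  constructor
  · rintro ⟨s, rfl⟩; exact ⟨s - t, by module⟩
  · rintro ⟨s, rfl⟩; exact ⟨t + s, by module⟩

theorem lineThrough_neg (p v : E3) : lineThrough p (-v) = lineThrough p v := by
  ext x
  constructor
  · rintro ⟨s, rfl⟩; exact ⟨-s, by module⟩
  · rintro ⟨s, rfl⟩; exact ⟨-s, by module⟩

/-- The lines `δ u + ℝ u` form a continuous system with center in the interior of `K`. -/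
structure CenteredSystem (K : Set E3) (δ : E3 → E3) : Prop where
  cont : ContinuousOn δ (Metric.sphere (0 : E3) 1)
  orth : ∀ u, ‖u‖ = 1 → ⟪δ u, u⟫ = 0
  even : ∀ u, ‖u‖ = 1 → δ (-u) = δ u
  meet : ∀ u v, ‖u‖ = 1 → ‖v‖ = 1 → ∀ s t : ℝ, δ u + s • u = δ v + t • v →
    δ u + s • u ∈ interior K ∨ v = u ∨ v = -u

theorem IsContinuousLineSystem.exists_centeredSystem {K : Set E3} {𝓛 : Set (Set E3)}
    (h : IsContinuousLineSystem 𝓛) (hcenter : lineSystemCenter 𝓛 ⊆ interior K) :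
    ∃ δ, CenteredSystem K δ ∧ ∀ u, ‖u‖ = 1 → lineThrough (δ u) u ∈ 𝓛 := by
  obtain ⟨⟨-, hex⟩, δ, hδ, hmin⟩ := h
  have hmem : ∀ u, ‖u‖ = 1 → lineThrough (δ u) u ∈ 𝓛 := by
    intro u hu
    obtain ⟨L, ⟨hL, p, rfl⟩, -⟩ := hex u hu
    rwa [← lineThrough_eq (hmin u hu _ hL ⟨p, rfl⟩).1]
  have horth : ∀ u, ‖u‖ = 1 → ⟪δ u, u⟫ = 0 := by
    intro u hu
    have h1 := (hmin u hu _ (hmem u hu) ⟨_, rfl⟩).2 _ ⟨-⟪δ u, u⟫, rfl⟩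
    have h2 := pow_le_pow_left₀ (norm_nonneg _) h1 2
    rw [norm_add_sq_real, real_inner_smul_right, norm_smul, hu, mul_one, Real.norm_eq_abs,
      sq_abs] at h2
    nlinarith
  refine ⟨δ, ⟨hδ, horth, fun u hu => ?_, fun u v hu hv s t hst => ?_⟩, hmem⟩
  · have hu' : ‖-u‖ = 1 := by rwa [norm_neg]
    obtain ⟨t, ht⟩ := (hmin (-u) hu' _ (hmem u hu) ⟨δ u, (lineThrough_neg _ _).symm⟩).1
    have h1 := horth (-u) hu'
    rw [ht, inner_neg_right, inner_add_left, horth u hu, real_inner_smul_left,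
      real_inner_self_eq_norm_sq, hu] at h1
    have : t = 0 := by linarith
    rw [ht, this, zero_smul, add_zero]
  · by_cases heq : lineThrough (δ u) u = lineThrough (δ v) v
    · right
      have h1 : δ v ∈ lineThrough (δ u) u := heq ▸ ⟨0, by simp⟩
      have h2 : δ v + v ∈ lineThrough (δ u) u := heq ▸ ⟨1, by simp⟩
      obtain ⟨a, ha⟩ := h1
      obtain ⟨b, hb⟩ := h2
      exact eq_or_eq_neg_of_smul hv hu (k := b - a)
        (by linear_combination (norm := module) hb - ha)
    · exact Or.inl (hcenter ⟨_, hmem u hu, _, hmem v hv, heq, ⟨s, rfl⟩, ⟨t, hst⟩⟩)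

namespace CenteredSystem

variable {K : Set E3} {δ : E3 → E3}

theorem exists_line_through (S : CenteredSystem K δ) (b : E3) :
    ∃ u, ‖u‖ = 1 ∧ ∃ t : ℝ, b = δ u + t • u := by
  have htan : ∀ u, ‖u‖ = 1 → ⟪δ u - b + ⟪b, u⟫ • u, u⟫ = 0 := fun u hu => by
    rw [inner_add_left, inner_sub_left, S.orth u hu, real_inner_smul_left,
      real_inner_self_eq_norm_sq, hu]
    ring
  have heven : ∀ u, ‖u‖ = 1 → δ (-u) - b + ⟪b, -u⟫ • -u = δ u - b + ⟪b, u⟫ • u := fun u hu => by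
    simp only [S.even u hu, inner_neg_right, smul_neg, neg_smul, neg_neg]
  obtain ⟨u, hu, h⟩ := exists_zero_of_even_tangent_field
    ((S.cont.sub continuousOn_const).add (by fun_prop)) htan heven
  have h' : δ u - b + ⟪b, u⟫ • u = 0 := h
  exact ⟨u, hu, ⟪b, u⟫, by linear_combination (norm := module) (-1 : ℝ) • h'⟩

theorem exists_mem_interior (S : CenteredSystem K δ) {u : E3} (hu : ‖u‖ = 1) :
    ∃ s : ℝ, δ u + s • u ∈ interior K := by
  obtain ⟨e', he0, hue', -⟩ := exists_orthogonal u u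
  obtain ⟨f', hf0, huf', hef'⟩ := exists_orthogonal u e'
  obtain ⟨e, he, hue, he'⟩ : ∃ e : E3, ‖e‖ = 1 ∧ ⟪u, e⟫ = 0 ∧ ⟪e, f'⟫ = 0 :=
    ⟨‖e'‖⁻¹ • e', norm_smul_inv_norm he0, by rw [real_inner_smul_right, hue', mul_zero],
      by rw [real_inner_smul_left, hef', mul_zero]⟩
  obtain ⟨f, hf, huf, hef⟩ : ∃ f : E3, ‖f‖ = 1 ∧ ⟪u, f⟫ = 0 ∧ ⟪e, f⟫ = 0 :=
    ⟨‖f'‖⁻¹ • f', norm_smul_inv_norm hf0, by rw [real_inner_smul_right, huf', mul_zero],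
      by rw [real_inner_smul_right, he', mul_zero]⟩
  have hfe : ⟪f, e⟫ = 0 := by rw [real_inner_comm, hef]
  have hunit : ∀ a b : ℝ, a ^ 2 + b ^ 2 = 1 → ‖a • e + b • f‖ = 1 := by
    intro a b hab
    rw [← pow_eq_one_iff_of_nonneg (norm_nonneg _) two_ne_zero, norm_add_sq_real, norm_smul,
      norm_smul, real_inner_smul_left, real_inner_smul_right, hef, he, hf]
    simpa using hab
  let w : ℝ → E3 := fun θ => Real.cos θ • e + Real.sin θ • f
  let n : ℝ → E3 := fun θ => -Real.sin θ • e + Real.cos θ • f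
  have hw1 : ∀ θ, ‖w θ‖ = 1 := fun θ => hunit _ _ (Real.cos_sq_add_sin_sq θ)
  have hn1 : ∀ θ, ‖n θ‖ = 1 := fun θ => hunit _ _ (by rw [neg_sq]; exact Real.sin_sq_add_cos_sq θ)
  have hw : Continuous fun θ => δ (w θ) := by
    rw [← continuousOn_univ]
    exact S.cont.comp (by fun_prop) fun θ _ => by simpa using hw1 θ
  have hg : Continuous fun θ => ⟪n θ, δ (w θ) - δ u⟫ :=
    Continuous.inner (by fun_prop) (hw.sub continuous_const)
  obtain ⟨θ, -, hθ⟩ := exists_zero_of_mul_nonpos (x := 0) (y := Real.pi) hg.continuousOn (by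
    have h1 : w Real.pi = -w 0 := by simp [w]
    have h2 : n Real.pi = -n 0 := by simp [n]
    rw [h1, h2, S.even _ (hw1 0), inner_neg_left]
    nlinarith [sq_nonneg ⟪n 0, δ (w 0) - δ u⟫])
  have huw : ⟪u, w θ⟫ = 0 := by
    simp only [w, inner_add_right, real_inner_smul_right, hue, huf]; ring
  have hnu : ⟪n θ, u⟫ = 0 := by
    rw [real_inner_comm]
    simp only [n, inner_add_right, real_inner_smul_right, hue, huf]; ring
  have hnw : ⟪n θ, w θ⟫ = 0 := by
    simp only [n, w, inner_add_right, inner_add_left, real_inner_smul_right, real_inner_smul_left,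
      hef, hfe, real_inner_self_eq_norm_sq, he, hf]
    ring
  have hn0 : n θ ≠ 0 := by intro h0; simpa [h0] using hn1 θ
  obtain ⟨a, b, hab⟩ := exists_combination hn0 hnu hnw hθ (by
    unfold Indep; rw [huw, hu, hw1]; norm_num)
  rcases S.meet u (w θ) hu (hw1 θ) a (-b)
    (by linear_combination (norm := module) -hab) with h | h | h
  · exact ⟨a, h⟩
  · rw [h, real_inner_self_eq_norm_sq, hu] at huw; norm_num at huw
  · rw [h, inner_neg_right, real_inner_self_eq_norm_sq, hu] at huw; norm_num at huw

theorem exists_lineField (S : CenteredSystem K δ) (hK : IsCompact K) (hc : Convex ℝ K) :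
    ∃ U, LineField K U ∧ ∀ y ∈ frontier K, ∃ t : ℝ, y = δ (U y) + t • U y := by
  have hex : ∀ y, ∃ v : E3, ‖v‖ = 1 ∧ ∃ t : ℝ, y = δ v + t • v ∧
      (y ∈ frontier K → ∃ s : ℝ, 0 < s ∧ y - s • v ∈ interior K) := by
    intro y
    obtain ⟨u, hu, t, ht⟩ := S.exists_line_through y
    obtain ⟨s, hs⟩ := S.exists_mem_interior hu
    rcases lt_or_ge s t with h | h
    · exact ⟨u, hu, t, ht, fun _ => ⟨t - s, by linarith, by
        convert hs using 1; nth_rewrite 1 [ht]; module⟩⟩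
    · refine ⟨-u, by rwa [norm_neg], -t, by rw [S.even u hu, smul_neg, neg_smul, neg_neg, ← ht],
        fun hy => ⟨s - t, lt_of_le_of_ne (by linarith) fun h0 => ?_, by
          convert hs using 1; nth_rewrite 1 [ht]; module⟩⟩
      rw [show s = t by linarith, ← ht] at hs
      exact ((mem_frontier_iff' hK).1 hy).2 hs
  choose U hU1 t ht hin using hex
  have htU : ∀ y, t y = ⟪y, U y⟫ := by
    intro y
    nth_rewrite 2 [ht y]
    rw [inner_add_left, S.orth _ (hU1 y), real_inner_smul_left, real_inner_self_eq_norm_sq, hU1]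
    ring
  have hpar : ∀ y z, (U z = U y ∨ U z = -U y) → ∃ k : ℝ, z = y + k • U y := by
    rintro y z (h | h)
    · refine ⟨t z - t y, ?_⟩
      have h1 := ht y
      have h2 := ht z
      rw [h] at h2
      linear_combination (norm := module) h2 - h1
    · refine ⟨-t z - t y, ?_⟩
      have h1 := ht y
      have h2 := ht z
      rw [h, S.even _ (hU1 y)] at h2
      linear_combination (norm := module) h2 - h1
  refine ⟨U, ⟨hK, hc, fun a ha => ?_, fun y _ => hU1 y, fun y hy => hin y hy,
    fun y _ z _ s r h => ?_, fun y _ z _ => hpar y z⟩, fun y _ => ⟨_, ht y⟩⟩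
  · rw [ContinuousWithinAt, tendsto_iff_ultrafilter]
    intro G hG
    have hGa : Tendsto (fun y => y) (G : Filter E3) (𝓝 a) := hG.trans nhdsWithin_le_nhds
    have hGf : ∀ᶠ y in (G : Filter E3), y ∈ frontier K := hG self_mem_nhdsWithin
    obtain ⟨u, hu, hlim⟩ := (isCompact_sphere (0 : E3) 1).ultrafilter_le_nhds (G.map U) (by
      rw [le_principal_iff]
      have : U ⁻¹' Metric.sphere (0 : E3) 1 ∈ (G : Filter E3) :=
        univ_mem' fun y => by simpa using hU1 y
      exact this)
    have hlim' : Tendsto U (G : Filter E3) (𝓝 u) := hlim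
    have hu1 : ‖u‖ = 1 := by simpa using hu
    have hδ : Tendsto (fun y => δ (U y)) (G : Filter E3) (𝓝 (δ u)) :=
      (S.cont u hu).tendsto.comp (tendsto_nhdsWithin_iff.2
        ⟨hlim', Eventually.of_forall fun y => by simpa using hU1 y⟩)
    have hau : a = δ u + ⟪a, u⟫ • u := by
      refine tendsto_nhds_unique hGa
        ((hδ.add ((hGa.inner hlim').smul hlim')).congr fun y => ?_)
      rw [← htU, ← ht]
    have hai := ((mem_frontier_iff' hK).1 ha).2
    rcases S.meet (U a) u (hU1 a) hu1 (t a) ⟪a, u⟫ (by rw [← ht, ← hau]) with h | h | h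
    · rw [← ht] at h; exact absurd h hai
    · rwa [← h]
    · exfalso
      obtain ⟨s, hs, hs'⟩ := hin a ha
      have hsu : a + s • u ∈ interior K := by
        rw [h, smul_neg, ← sub_eq_add_neg]; exact hs'
      obtain ⟨y, hyi, hyf⟩ := (((hGa.add (hlim'.const_smul s)).eventually
        (isOpen_interior.mem_nhds hsu)).and hGf).exists
      obtain ⟨r, hr, hr'⟩ := hin y hyf
      exact absurd (neg_of_mem_interior hc ((mem_frontier_iff' hK).1 hyf).2 hr hr' hyi) hs.not_gt
  · have h1 : y + s • U y = δ (U y) + (t y + s) • U y := by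
      nth_rewrite 1 [ht y]; module
    have h2 : z + r • U z = δ (U z) + (t z + r) • U z := by
      nth_rewrite 1 [ht z]; module
    rw [h1, h2] at h
    rw [h1]
    rcases S.meet _ _ (hU1 y) (hU1 z) _ _ h with h | h
    · exact Or.inl h
    · obtain ⟨k, hk⟩ := hpar y z h
      exact Or.inr ⟨k, hk, h⟩

end CenteredSystem

theorem IsPlaneWithNormal.eq_planeAt {H : Set E3} {n y : E3} (h : IsPlaneWithNormal H n)
    (hy : y ∈ H) : H = planeAt y n := by
  obtain ⟨-, c, rfl⟩ := h
  have hy' : ⟪n, y⟫ = c := hy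
  ext x
  rw [mem_planeAt, inner_sub_right, hy', sub_eq_zero]
  rfl

theorem frontier_nonempty {K : Set E3} (hK : IsCompact K) (hi : (interior K).Nonempty) :
    (frontier K).Nonempty := by
  rw [Set.nonempty_iff_ne_empty]
  intro h
  rw [← isClopen_iff_frontier_eq_empty, isClopen_iff] at h
  rcases h with rfl | rfl
  · simp at hi
  · exact noncompact_univ E3 hK

end

/-- If moreover for each line of the continuous system one of the two
elliptic sections is a circle, then the boundary is a sphere. -/
theorem line_system_circular_sections_sphere (K : Set E3) (hK : IsConvexBody K)
    (α : ℝ) (hα : 0 < α) (𝓛 : Set (Set E3)) (h𝓛 : IsContinuousLineSystem 𝓛)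
    (hcenter : lineSystemCenter 𝓛 ⊆ interior K)
    (h : ∀ L ∈ 𝓛, ∃ (H₁ H₂ : Set E3) (n₁ n₂ : E3),
      IsPlaneWithNormal H₁ n₁ ∧ IsPlaneWithNormal H₂ n₂ ∧
      H₁ ∩ H₂ = L ∧
      α ≤ Real.arccos |⟪n₁, n₂⟫| ∧
      IsEllipse (frontier K ∩ H₁) ∧ IsEllipse (frontier K ∩ H₂) ∧
      (IsCircle (frontier K ∩ H₁) ∨ IsCircle (frontier K ∩ H₂))) :
    IsSphere (frontier K) := by
  obtain ⟨hKc, hKv, hKi⟩ := hK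
  obtain ⟨δ, S, hmem⟩ := h𝓛.exists_centeredSystem hcenter
  obtain ⟨U, F, hδU⟩ := S.exists_lineField hKc hKv
  have hβ : Real.cos (min α (Real.pi / 2)) < 1 := by
    rw [← Real.cos_zero]
    exact Real.cos_lt_cos_of_nonneg_of_le_pi_div_two le_rfl (min_le_right _ _)
      (lt_min hα (by positivity))
  have H : HasSections K U (Real.cos (min α (Real.pi / 2))) := by
    intro y hy
    have hU1 := F.norm_eq y hy
    obtain ⟨H₁, H₂, n₁, n₂, h₁, h₂, hL, hang, he₁, he₂, hcirc⟩ := h _ (hmem _ hU1)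
    obtain ⟨t, ht⟩ := hδU y hy
    have hyL : y ∈ H₁ ∩ H₂ := hL ▸ ⟨t, ht⟩
    have hyL' : y + U y ∈ H₁ ∩ H₂ := hL ▸ ⟨t + 1, by nth_rewrite 1 [ht]; module⟩
    obtain rfl := h₁.eq_planeAt hyL.1
    obtain rfl := h₂.eq_planeAt hyL.2
    have hU₁ : ⟪n₁, U y⟫ = 0 := by simpa [mem_planeAt] using hyL'.1
    have hU₂ : ⟪n₂, U y⟫ = 0 := by simpa [mem_planeAt] using hyL'.2
    have hle : |⟪n₁, n₂⟫| ≤ 1 := by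
      simpa [h₁.1, h₂.1] using abs_real_inner_le_norm n₁ n₂
    have hang' : |⟪n₁, n₂⟫| ≤ Real.cos (min α (Real.pi / 2)) := by
      rw [← Real.cos_arccos (by have := abs_nonneg ⟪n₁, n₂⟫; linarith) hle]
      exact Real.cos_le_cos_of_nonneg_of_le_pi (le_min hα.le (by positivity)) (Real.arccos_le_pi _)
        ((min_le_left _ _).trans hang)
    rcases hcirc with hcirc | hcirc
    · exact ⟨n₁, n₂, ⟨h₁.1, hU₁, hcirc.cosphericalSection hKc hKv⟩, h₂.1, hU₂, hang',
        he₂.sphericallyRigid⟩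
    · exact ⟨n₂, n₁, ⟨h₂.1, hU₂, hcirc.cosphericalSection hKc hKv⟩, h₁.1, hU₁,
        by rwa [real_inner_comm], he₁.sphericallyRigid⟩
  obtain ⟨m, ρ, hS⟩ := F.onSphere_frontier hKi (frontier_nonempty hKc hKi) H hβ
  exact isSphere_of_onSphere hKc hKv hKi hS
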